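/- arXiv:2501.07644 — 3 statements merged into one kernel-verified Lean document; each statement's English description precedes it below -/
import Mathlib

section
/- Let 𝒜 be a finite set of events in a finite probability space, let Γ be a graph with vertex set 𝒜, and let x_A ∈ [0,1) for each A ∈ 𝒜. Suppose that for every A ∈ 𝒜 and every subset 𝒜' ⊆ 𝒜 \ {A} such that no A' ∈ 𝒜' is adjacent to A in Γ and ℙ[⋂_{A'∈𝒜'} \overline{A'}] > 0, one has ℙ[A | ⋂_{A'∈𝒜'} \overline{A'}] ≤ x_A · ∏_{B : AB ∈ E(Γ)} (1 - x_B). Then with positive probability none of the events in 𝒜 occur, i.e. ℙ[⋂_{A∈𝒜} \overline{A}] > 0. -/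
open Finset

/-- The probability of the event `s` in a finite probability space with
weights `w`. -/
def Pr {Ω : Type*} (w : Ω → ℝ) (s : Finset Ω) : ℝ := ∑ a ∈ s, w a

/-- The lopsided Lovász local lemma.  The finite probability space is
given by a finite type `Ω` with nonnegative weights `w` summing to `1`; the events are
`A i` for `i` in the finite index type `ι`, and `Γ` is a graph on the events.  If for
every event `A i` and every family `s` of events non-adjacent to `i` (not containing
`i`) whose complements intersect in an event of positive probability the conditional
probability of `A i` given that none of the events of `s` occur is at most
`x i * ∏_{b ∼ i} (1 - x b)`, then with positive probability no event occurs. -/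
theorem lopsided_local_lemma {Ω ι : Type*} [Fintype Ω] [DecidableEq Ω] [Fintype ι]
    [DecidableEq ι]
    (w : Ω → ℝ) (hw : ∀ a, 0 ≤ w a) (hw1 : ∑ a, w a = 1)
    (A : ι → Finset Ω) (Γ : SimpleGraph ι) [DecidableRel Γ.Adj]
    (x : ι → ℝ) (hx0 : ∀ i, 0 ≤ x i) (hx1 : ∀ i, x i < 1)
    (hcond : ∀ (i : ι) (s : Finset ι), i ∉ s → (∀ i' ∈ s, ¬ Γ.Adj i i') →
      0 < Pr w (Finset.univ.filter fun ω => ∀ i' ∈ s, ω ∉ A i') →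
      Pr w ((A i) ∩ Finset.univ.filter fun ω => ∀ i' ∈ s, ω ∉ A i') /
          Pr w (Finset.univ.filter fun ω => ∀ i' ∈ s, ω ∉ A i') ≤
        x i * ∏ b ∈ Finset.univ.filter fun b => Γ.Adj i b, (1 - x b)) :
    0 < Pr w (Finset.univ.filter fun ω => ∀ i : ι, ω ∉ A i) := by
  classical
  set Q : Finset ι → ℝ := fun s => Pr w (Finset.univ.filter fun ω => ∀ i' ∈ s, ω ∉ A i') with hQ
  have hmono : ∀ s t : Finset Ω, s ⊆ t → Pr w s ≤ Pr w t := fun s t h =>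
    Finset.sum_le_sum_of_subset_of_nonneg h (fun a _ _ => hw a)
  have hanti : ∀ s t : Finset ι, s ⊆ t → Q t ≤ Q s := by
    intro s t h
    apply hmono
    intro ω
    simp only [Finset.mem_filter, Finset.mem_univ, true_and]
    exact fun hω i hi => hω i (h hi)
  have hsplit : ∀ (i : ι) (s : Finset ι),
      Pr w ((A i) ∩ Finset.univ.filter fun ω => ∀ i' ∈ s, ω ∉ A i') + Q (insert i s) = Q s := by
    intro i s
    simp only [hQ, Pr]
    rw [← Finset.sum_union]
    · congr 1
      ext ω
      simp only [Finset.mem_union, Finset.mem_inter, Finset.mem_filter, Finset.mem_univ, true_and,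
        Finset.forall_mem_insert]
      tauto
    · rw [Finset.disjoint_left]
      intro ω
      simp only [Finset.mem_inter, Finset.mem_filter, Finset.mem_univ, true_and,
        Finset.forall_mem_insert]
      tauto
  have key : ∀ s : Finset ι, 0 < Q s ∧ ∀ i, i ∉ s → (1 - x i) * Q s ≤ Q (insert i s) := by
    intro s
    induction s using Finset.strongInduction with
    | H s ih =>
      have hpos : 0 < Q s := by
        rcases s.eq_empty_or_nonempty with rfl | ⟨j, hj⟩
        · simp [hQ, Pr, hw1]
        · obtain ⟨h1, h2⟩ := ih (s.erase j) (Finset.erase_ssubset hj)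
          have h3 := h2 j (Finset.notMem_erase j s)
          rw [Finset.insert_erase hj] at h3
          exact lt_of_lt_of_le (mul_pos (sub_pos.2 (hx1 j)) h1) h3
      refine ⟨hpos, fun i hi => ?_⟩
      set s1 := s.filter fun b => Γ.Adj i b with hs1
      set s2 := s.filter fun b => ¬ Γ.Adj i b with hs2
      have hchain : ∀ t : Finset ι, t ⊆ s1 → (∏ b ∈ t, (1 - x b)) * Q s2 ≤ Q (t ∪ s2) := by
        intro t
        induction t using Finset.induction_on with
        | empty => intro _; simp
        | insert j t hj iht =>
          intro hsub
          have hj1 : j ∈ s1 := hsub (Finset.mem_insert_self j t)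
          have ht1 : t ⊆ s1 := fun b hb => hsub (Finset.mem_insert_of_mem hb)
          have hjs := Finset.mem_filter.1 hj1
          have hjn : j ∉ t ∪ s2 := by
            intro h
            rcases Finset.mem_union.1 h with h | h
            · exact hj h
            · exact (Finset.mem_filter.1 h).2 hjs.2
          have hss : t ∪ s2 ⊂ s := by
            refine (Finset.ssubset_iff_of_subset ?_).2 ⟨j, hjs.1, hjn⟩
            exact Finset.union_subset (ht1.trans (Finset.filter_subset _ _))
              (Finset.filter_subset _ _)
          have h2 := (ih _ hss).2 j hjn
          rw [Finset.prod_insert hj, Finset.insert_union, mul_assoc]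
          exact (mul_le_mul_of_nonneg_left (iht ht1) (sub_pos.2 (hx1 j)).le).trans h2
      have hch := hchain s1 subset_rfl
      rw [Finset.filter_union_filter_not_eq] at hch
      have hpos2 : 0 < Q s2 := hpos.trans_le (hanti _ _ (Finset.filter_subset _ _))
      have hc := hcond i s2 (fun h => hi (Finset.mem_filter.1 h).1)
        (fun b hb => (Finset.mem_filter.1 hb).2) hpos2
      rw [div_le_iff₀ hpos2] at hc
      have hR : Pr w ((A i) ∩ Finset.univ.filter fun ω => ∀ i' ∈ s, ω ∉ A i') ≤
          Pr w ((A i) ∩ Finset.univ.filter fun ω => ∀ i' ∈ s2, ω ∉ A i') := by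
        apply hmono
        intro ω
        simp only [Finset.mem_inter, Finset.mem_filter, Finset.mem_univ, true_and]
        exact fun h => ⟨h.1, fun b hb => h.2 b (Finset.mem_filter.1 hb).1⟩
      have hprod : ∏ b ∈ Finset.univ.filter (fun b => Γ.Adj i b), (1 - x b) ≤
          ∏ b ∈ s1, (1 - x b) := by
        have hsub : s1 ⊆ Finset.univ.filter (fun b => Γ.Adj i b) :=
          Finset.filter_subset_filter _ (Finset.subset_univ s)
        rw [← Finset.prod_sdiff hsub]
        refine mul_le_of_le_one_left
          (Finset.prod_nonneg fun b _ => (sub_pos.2 (hx1 b)).le) ?_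
        exact Finset.prod_le_one (fun b _ => (sub_pos.2 (hx1 b)).le)
          (fun b _ => by linarith [hx0 b])
      have h5 : x i * (∏ b ∈ Finset.univ.filter (fun b => Γ.Adj i b), (1 - x b)) * Q s2
          ≤ x i * Q s := by
        rw [mul_assoc]
        exact mul_le_mul_of_nonneg_left
          ((mul_le_mul_of_nonneg_right hprod hpos2.le).trans hch) (hx0 i)
      have h6 := hsplit i s
      have h7 := hR.trans (hc.trans h5)
      linarith
  have h := (key Finset.univ).1
  simpa [hQ] using h
end

section
/- Let 𝒜 be a finite set of events in a finite probability space, let p ∈ [0,1/2)^𝒜, and let Γ be a p-dependency graph for 𝒜. If for every A ∈ 𝒜 one has ∑_{B : AB ∈ E(Γ)} p_B ≤ 1/4, then with positive probability none of the events in 𝒜 occur, i.e. ℙ[⋂_{A∈𝒜} \overline{A}] > 0. -/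
open Finset

def Nn {Ω ι : Type*} [Fintype Ω] [DecidableEq Ω] (A : ι → Finset Ω) (s : Finset ι) : Finset Ω :=
  Finset.univ.filter fun ω => ∀ i' ∈ s, ω ∉ A i'

theorem Pr_mono' {Ω : Type*} (w : Ω → ℝ) (hw : ∀ a, 0 ≤ w a) {s t : Finset Ω} (h : s ⊆ t) :
    Pr w s ≤ Pr w t :=
  Finset.sum_le_sum_of_subset_of_nonneg h (fun a _ _ => hw a)

theorem Nn_split {Ω ι : Type*} [Fintype Ω] [DecidableEq Ω] [DecidableEq ι] (w : Ω → ℝ)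
    (A : ι → Finset Ω) (s : Finset ι) (i : ι) :
    Pr w (Nn A s) = Pr w (Nn A (insert i s)) + Pr w (A i ∩ Nn A s) := by
  unfold Pr
  rw [← Finset.sum_union]
  · congr 1
    ext ω
    simp only [Nn, Finset.mem_union, Finset.mem_inter, Finset.mem_filter, Finset.mem_univ,
      true_and, Finset.forall_mem_insert]
    tauto
  · rw [Finset.disjoint_left]
    intro ω h1 h2
    simp only [Nn, Finset.mem_inter, Finset.mem_filter, Finset.mem_univ,
      true_and, Finset.forall_mem_insert] at h1 h2
    exact h1.1 h2.1

theorem Nn_anti {Ω ι : Type*} [Fintype Ω] [DecidableEq Ω] (A : ι → Finset Ω) {s t : Finset ι}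
    (h : s ⊆ t) : Nn A t ⊆ Nn A s := by
  intro ω
  simp only [Nn, Finset.mem_filter, Finset.mem_univ, true_and]
  exact fun H i hi => H i (h hi)

theorem Nn_union {Ω ι : Type*} [Fintype Ω] [DecidableEq Ω] [DecidableEq ι] (w : Ω → ℝ)
    (hw : ∀ a, 0 ≤ w a) (A : ι → Finset Ω) (t u : Finset ι) :
    Pr w (Nn A t) ≤ Pr w (Nn A (u ∪ t)) + ∑ b ∈ u, Pr w (A b ∩ Nn A t) := by
  induction u using Finset.induction_on with
  | empty => simp
  | insert b u hb ih =>
    rw [Finset.sum_insert hb, Finset.insert_union]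
    have h1 := Nn_split w A (u ∪ t) b
    have h2 : Pr w (A b ∩ Nn A (u ∪ t)) ≤ Pr w (A b ∩ Nn A t) :=
      Pr_mono' w hw (Finset.inter_subset_inter_left (Nn_anti A Finset.subset_union_right))
    linarith

/-- Local lemma for `p`-dependency graphs.  The finite probability space
is given by a finite type `Ω` with nonnegative weights `w` summing to `1`; the events
are `A i` for `i` in the finite index type `ι`.  `Γ` is a `p`-dependency graph for the
events, with `p i < 1/2` for every `i`: for every event `A i` and every family `s` of
events non-adjacent to `i` (not containing `i`) whose complements intersect in an
event of positive probability, the conditional probability of `A i` given that none of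
the events of `s` occur is at most `p i`.  If `∑_{b ∼ i} p b ≤ 1/4` for every `i`,
then with positive probability no event occurs. -/
theorem local_lemma_dependency_graph {Ω ι : Type*} [Fintype Ω] [DecidableEq Ω]
    [Fintype ι] [DecidableEq ι]
    (w : Ω → ℝ) (hw : ∀ a, 0 ≤ w a) (hw1 : ∑ a, w a = 1)
    (A : ι → Finset Ω) (Γ : SimpleGraph ι) [DecidableRel Γ.Adj]
    (p : ι → ℝ) (hp0 : ∀ i, 0 ≤ p i) (hp1 : ∀ i, p i < 1 / 2)
    (hdep : ∀ (i : ι) (s : Finset ι), i ∉ s → (∀ i' ∈ s, ¬ Γ.Adj i i') →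
      0 < Pr w (Finset.univ.filter fun ω => ∀ i' ∈ s, ω ∉ A i') →
      Pr w ((A i) ∩ Finset.univ.filter fun ω => ∀ i' ∈ s, ω ∉ A i') /
          Pr w (Finset.univ.filter fun ω => ∀ i' ∈ s, ω ∉ A i') ≤ p i)
    (hsum : ∀ i : ι, ∑ b ∈ Finset.univ.filter (fun b => Γ.Adj i b), p b ≤ 1 / 4) :
    0 < Pr w (Finset.univ.filter fun ω => ∀ i : ι, ω ∉ A i) := by
  have hdep' : ∀ (i : ι) (s : Finset ι), i ∉ s → (∀ i' ∈ s, ¬ Γ.Adj i i') →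
      0 < Pr w (Nn A s) → Pr w (A i ∩ Nn A s) ≤ p i * Pr w (Nn A s) := by
    intro i s h1 h2 h3
    have h4 := hdep i s h1 h2
    have e : (Finset.univ.filter fun ω => ∀ i' ∈ s, ω ∉ A i') = Nn A s := by
      ext ω; simp [Nn]
    rw [e] at h4
    exact (div_le_iff₀ h3).1 (h4 h3)
  have key : ∀ s : Finset ι, 0 < Pr w (Nn A s) ∧
      ∀ i, i ∉ s → Pr w (A i ∩ Nn A s) ≤ 2 * p i * Pr w (Nn A s) := by
    intro s
    induction s using Finset.strongInduction with
    | H s ih =>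
      have hpos : 0 < Pr w (Nn A s) := by
        rcases s.eq_empty_or_nonempty with rfl | ⟨i, hi⟩
        · simp [Nn, Pr, hw1]
        · obtain ⟨h1, h2⟩ := ih (s.erase i) (Finset.erase_ssubset hi)
          have h3 := h2 i (Finset.notMem_erase i s)
          have h4 := Nn_split w A (s.erase i) i
          rw [Finset.insert_erase hi] at h4
          have h5 := mul_pos (show 0 < 1 - 2 * p i by linarith [hp1 i]) h1
          linarith
      refine ⟨hpos, fun i hi => ?_⟩
      by_cases hall : ∀ i' ∈ s, ¬ Γ.Adj i i'
      · have h1 := hdep' i s hi hall hpos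
        have h2 := mul_nonneg (hp0 i) hpos.le
        linarith
      · push Not at hall
        obtain ⟨j, hj, hij⟩ := hall
        have hts : s.filter (fun b => ¬ Γ.Adj i b) ⊂ s :=
          Finset.filter_ssubset.2 ⟨j, hj, not_not.2 hij⟩
        obtain ⟨h1, h2⟩ := ih _ hts
        have h3 := hdep' i (s.filter (fun b => ¬ Γ.Adj i b))
          (fun h => hi (hts.1 h)) (fun b hb => (Finset.mem_filter.1 hb).2) h1
        have h4 := Nn_union w hw A (s.filter (fun b => ¬ Γ.Adj i b)) (s.filter (fun b => Γ.Adj i b))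
        rw [Finset.filter_union_filter_not_eq] at h4
        set t := s.filter (fun b => ¬ Γ.Adj i b) with ht
        have h5 : ∑ b ∈ s.filter (fun b => Γ.Adj i b), Pr w (A b ∩ Nn A t) ≤
            ∑ b ∈ s.filter (fun b => Γ.Adj i b), 2 * p b * Pr w (Nn A t) := by
          refine Finset.sum_le_sum fun b hb => h2 b fun hbt => ?_
          exact (Finset.mem_filter.1 hbt).2 (Finset.mem_filter.1 hb).2
        rw [← Finset.sum_mul, ← Finset.mul_sum] at h5
        have h6 : ∑ b ∈ s.filter (fun b => Γ.Adj i b), p b ≤ 1 / 4 :=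
          (Finset.sum_le_sum_of_subset_of_nonneg
            (Finset.filter_subset_filter _ (Finset.subset_univ s))
            (fun b _ _ => hp0 b)).trans (hsum i)
        have h7 : Pr w (A i ∩ Nn A s) ≤ Pr w (A i ∩ Nn A t) :=
          Pr_mono' w hw (Finset.inter_subset_inter_left (Nn_anti A hts.1))
        have h8 := mul_le_mul_of_nonneg_right h6 h1.le
        have h9 : Pr w (Nn A t) ≤ 2 * Pr w (Nn A s) := by linarith
        have h10 := mul_le_mul_of_nonneg_left h9 (hp0 i)
        linarith
  have h := (key Finset.univ).1
  simpa [Nn] using h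
end

section
/- In the Setup: let H be a loose Hamilton cycle in G and P_0 ⊆ H a loose path of length t. Then there exist at least γ·n^{m-1} distinct t-balanced m-splittings 𝒫 of H with P_0 ∈ 𝒫 such that 𝒫 is suitable for P_0 and V(𝒫) admits a viable partition. -/
open Finset

open scoped Classical

noncomputable section

/-- A `k`-uniform hypergraph with vertices drawn from `ℕ`. -/
structure HGraph (k : ℕ) where
  verts : Finset ℕ
  edges : Finset (Finset ℕ)
  edge_sub : ∀ e ∈ edges, e ⊆ verts
  edge_card : ∀ e ∈ edges, e.card = k

namespace HGraph

variable {k : ℕ}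

/-- The number of edges of `G` containing the vertex set `S`. -/
def degOn (G : HGraph k) (S : Finset ℕ) : ℕ :=
  (G.edges.filter fun e => S ⊆ e).card

/-- The relative degree `deg_G(S; W)`: edges containing `S` whose other vertices lie in `W`. -/
def degIn (G : HGraph k) (S W : Finset ℕ) : ℕ :=
  (G.edges.filter fun e => S ⊆ e ∧ e \ S ⊆ W).card

/-- The edge set of the induced subhypergraph `G[U]`. -/
def inducedEdges (G : HGraph k) (U : Finset ℕ) : Finset (Finset ℕ) :=
  G.edges.filter fun e => e ⊆ U

/-- `δ_j(G) ≥ d`. -/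
def MinDegGe (G : HGraph k) (j : ℕ) (d : ℝ) : Prop :=
  ∀ T ⊆ G.verts, T.card = j → d ≤ (G.degOn T : ℝ)

/-- `δ_j(G[U]) ≥ d`. -/
def MinDegOnGe (G : HGraph k) (j : ℕ) (U : Finset ℕ) (d : ℝ) : Prop :=
  ∀ T ⊆ U, T.card = j → d ≤ (((G.inducedEdges U).filter fun e => T ⊆ e).card : ℝ)

end HGraph

/-- A colouring is rainbow on a set of edges if distinct edges receive distinct colours. -/
def RainbowEdges (χ : Finset ℕ → ℕ) (E : Finset (Finset ℕ)) : Prop :=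
  ∀ e ∈ E, ∀ f ∈ E, χ e = χ f → e = f

/-- `χ` is globally `b`-bounded on `G`: every colour class has at most `b` edges. -/
def GloballyBounded {k : ℕ} (G : HGraph k) (χ : Finset ℕ → ℕ) (b : ℝ) : Prop :=
  ∀ c : ℕ, ((G.edges.filter fun e => χ e = c).card : ℝ) ≤ b

/-- The number of edges of a loose Hamilton cycle of `G`. -/
def numE {k : ℕ} (G : HGraph k) : ℕ := G.verts.card / (k - 1)

/-- A loose Hamilton cycle in `G`, recorded by a cyclic ordering of the vertices:
`σ` enumerates the vertices, and the `i`-th edge consists of the `k` consecutive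
vertices starting at position `i(k-1)`, so that consecutive edges share exactly one
vertex (when `(k-1) ∣ |V(G)|`). -/
structure LooseHamCycle (k : ℕ) (G : HGraph k) where
  σ : ℕ → ℕ
  injOn : Set.InjOn σ (Set.Iio G.verts.card)
  image_eq : (Finset.range G.verts.card).image σ = G.verts
  edges_mem : ∀ i < numE G,
    (Finset.range k).image (fun r => σ ((i * (k - 1) + r) % G.verts.card)) ∈ G.edges

namespace LooseHamCycle

variable {k : ℕ} {G : HGraph k}

/-- The `i`-th edge of the cycle. -/
def cedge (H : LooseHamCycle k G) (i : ℕ) : Finset ℕ :=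
  (Finset.range k).image fun r => H.σ ((i * (k - 1) + r) % G.verts.card)

/-- The edge set of the cycle. -/
def cedges (H : LooseHamCycle k G) : Finset (Finset ℕ) :=
  (Finset.range (numE G)).image H.cedge

/-- The edge set of the increasing loose path of length `t` starting at edge `i`. -/
def pEdges (H : LooseHamCycle k G) (i t : ℕ) : Finset (Finset ℕ) :=
  (Finset.range t).image fun r => H.cedge ((i + r) % numE G)

/-- The vertex set of the increasing loose path of length `t` starting at edge `i`. -/
def pVerts (H : LooseHamCycle k G) (i t : ℕ) : Finset ℕ :=
  (Finset.range (t * (k - 1) + 1)).image fun r => H.σ ((i * (k - 1) + r) % G.verts.card)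

/-- The first endvertex of the increasing loose path starting at edge `i`. -/
def pEndA (H : LooseHamCycle k G) (i : ℕ) : ℕ := H.σ ((i * (k - 1)) % G.verts.card)

/-- The last endvertex of the increasing loose path of length `t` starting at edge `i`. -/
def pEndB (H : LooseHamCycle k G) (i t : ℕ) : ℕ :=
  H.σ ((i * (k - 1) + t * (k - 1)) % G.verts.card)

/-- The endvertex pair of the increasing loose path of length `t` starting at edge `i`. -/
def pEnds (H : LooseHamCycle k G) (i t : ℕ) : Finset ℕ := {H.pEndA i, H.pEndB i t}

end LooseHamCycle

/-- The loose Hamilton cycle threshold `δ_j^k(1)`: the least `δ ≥ 0` such that for every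
`ε > 0` all sufficiently large `k`-graphs `G` (with `(k-1) ∣ n`) satisfying
`δ_j(G) ≥ (δ+ε)n^{k-j}` contain a loose Hamilton cycle. -/
noncomputable def looseHamThreshold (j k : ℕ) : ℝ :=
  sInf {δ : ℝ | 0 ≤ δ ∧ ∀ ε : ℝ, 0 < ε → ∃ n₀ : ℕ, ∀ n : ℕ, n₀ ≤ n → (k - 1) ∣ n →
    ∀ G : HGraph k, G.verts.card = n →
      G.MinDegGe j ((δ + ε) * (n : ℝ) ^ (k - j)) → Nonempty (LooseHamCycle k G)}

/-- `T = t(k-1)+1`. -/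
def TOf (k t : ℕ) : ℕ := t * (k - 1) + 1
/-- `m̃ = t^{100k}`. -/
def mtOf (k t : ℕ) : ℕ := t ^ (100 * k)
/-- `m = T·m̃`. -/
def mOf (k t : ℕ) : ℕ := TOf k t * mtOf k t
/-- `M = T·m`. -/
def MOf (k t : ℕ) : ℕ := TOf k t * mOf k t

section Splittings

variable {k : ℕ} {G : HGraph k}

/-- `I` is the index set of a `t`-balanced splitting of `H`: a collection of
pairwise vertex-disjoint increasing loose paths of length `t` of `H`. -/
def IsSplitting (H : LooseHamCycle k G) (t : ℕ) (I : Finset ℕ) : Prop :=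
  (∀ i ∈ I, i < numE G) ∧
    ∀ i ∈ I, ∀ i' ∈ I, i ≠ i' → Disjoint (H.pVerts i t) (H.pVerts i' t)

/-- `V(𝒫)` for the splitting indexed by `I`. -/
def splitVerts (H : LooseHamCycle k G) (t : ℕ) (I : Finset ℕ) : Finset ℕ :=
  I.biUnion fun i => H.pVerts i t

/-- `V^E(𝒫)` for the splitting indexed by `I`. -/
def splitEnds (H : LooseHamCycle k G) (t : ℕ) (I : Finset ℕ) : Finset ℕ :=
  I.biUnion fun i => H.pEnds i t

/-- `V^I(𝒫)` for the splitting indexed by `I`. -/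
def splitInt (H : LooseHamCycle k G) (t : ℕ) (I : Finset ℕ) : Finset ℕ :=
  splitVerts H t I \ splitEnds H t I

/-- A vertex set `S` is transverse with respect to the splitting indexed by `I`. -/
def Transverse (H : LooseHamCycle k G) (t : ℕ) (I : Finset ℕ) (S : Finset ℕ) : Prop :=
  ∀ i ∈ I, (S ∩ H.pVerts i t).card ≤ 1

/-- The splitting indexed by `I` is suitable for the path `P₀` (the increasing path
of length `t` starting at edge `i₀`). -/
def Suitable (χ : Finset ℕ → ℕ) (ε : ℝ) (m : ℕ) (H : LooseHamCycle k G)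
    (t : ℕ) (I : Finset ℕ) (i₀ : ℕ) : Prop :=
  (∀ S ⊆ splitVerts H t I \ H.pVerts i₀ t, S.card = k - 1 → Transverse H t I S →
    ((((G.inducedEdges (splitVerts H t I)).filter
        fun e => S ⊆ e ∧ ∃ f ∈ H.cedges, χ f = χ e).card : ℝ) ≤ ε * (m : ℝ) / 4)) ∧
  (∀ X ⊆ splitVerts H t I \ H.pVerts i₀ t, Transverse H t I X →
    ∀ e ∈ G.inducedEdges X, ∀ f ∈ G.inducedEdges X,
      χ e = χ f → (e ∩ f).card = 1 → False) ∧
  (∀ e ∈ G.inducedEdges (splitVerts H t I \ H.pVerts i₀ t),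
    ∀ f ∈ G.inducedEdges (splitVerts H t I \ H.pVerts i₀ t),
      χ e = χ f → Disjoint e f → Transverse H t I e → Transverse H t I f →
      ∃ i ∈ I, ∃ i' ∈ I, i ≠ i' ∧
        (H.pVerts i t ∩ e).Nonempty ∧ (H.pVerts i t ∩ f).Nonempty ∧
        (H.pVerts i' t ∩ e).Nonempty ∧ (H.pVerts i' t ∩ f).Nonempty)

/-- The cyclic successor of `i` within the index set `I`. -/
def nextIdx (I : Finset ℕ) (i : ℕ) : ℕ :=
  if h : (I.filter fun i' => i < i').Nonempty then (I.filter fun i' => i < i').min' h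
  else if h2 : I.Nonempty then I.min' h2 else 0

/-- `M` is a rerouting of the splitting indexed by `I`: a partition of `V^E(𝒫)` into
pairs such that identifying the two vertices of each pair connects the paths of
`H[V(G) ∖ V^I(𝒫)]` into a single loose cycle (the arcs of `H` between consecutive
paths of the splitting, together with the identified pairs, form a connected graph). -/
def IsRerouting (H : LooseHamCycle k G) (t : ℕ) (I : Finset ℕ)
    (M : Finset (Finset ℕ)) : Prop :=
  (∀ p ∈ M, p.card = 2 ∧ p ⊆ splitEnds H t I) ∧
  (∀ p ∈ M, ∀ q ∈ M, p ≠ q → Disjoint p q) ∧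
  M.biUnion id = splitEnds H t I ∧
  ∀ u ∈ splitEnds H t I, ∀ v ∈ splitEnds H t I,
    Relation.ReflTransGen
      (fun a b => ({a, b} : Finset ℕ) ∈ M ∨
        ∃ i ∈ I, ({a, b} : Finset ℕ) = {H.pEndB i t, H.pEndA (nextIdx I i)}) u v

/-- `X` (indexed over `Finset.range T`) is a viable partition of `V(𝒫)` for the
`t`-balanced splitting indexed by `I`. -/
def IsViablePartition (j : ℕ) (ε : ℝ) (t : ℕ) (H : LooseHamCycle k G)
    (I : Finset ℕ) (X : ℕ → Finset ℕ) : Prop :=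
  (Finset.range (TOf k t)).biUnion X = splitVerts H t I ∧
  (∀ h ∈ Finset.range (TOf k t), ∀ h' ∈ Finset.range (TOf k t), h ≠ h' →
    Disjoint (X h) (X h')) ∧
  (∀ h ∈ Finset.range (TOf k t), Transverse H t I (X h)) ∧
  (∃ M : Finset (Finset ℕ), IsRerouting H t I M ∧
    ∀ h ∈ Finset.range (TOf k t), (M.filter fun p => p ⊆ X h).card = mtOf k t) ∧
  ∀ h ∈ Finset.range (TOf k t),
    G.MinDegOnGe j (X h) ((looseHamThreshold j k + ε / 2) * (mOf k t : ℝ) ^ (k - j))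

/-- The vertex set spanned by a set of edges. -/
def eVerts (E : Finset (Finset ℕ)) : Finset ℕ := E.biUnion id

/-- `(𝒫, H', 𝒫')` is a `(P₀,H)`-switching of size `m`, where `𝒫` is the `t`-balanced
splitting of `H` indexed by `I` containing `P₀` (the increasing path of length `t`
starting at edge `i₀`), and `𝒫'` is the `2t`-bounded splitting of `H'` whose paths are
recorded in `Q` as pairs (edge set, endvertex pair). -/
def IsSwitching (t m : ℕ) (H : LooseHamCycle k G) (i₀ : ℕ) (I : Finset ℕ)
    (H' : LooseHamCycle k G) (Q : Finset (Finset (Finset ℕ) × Finset ℕ)) : Prop :=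
  IsSplitting H t I ∧ I.card = m ∧ i₀ ∈ I ∧
  Q.card = m ∧
  (∀ q ∈ Q, ∃ i ℓ : ℕ, i < numE G ∧ 1 ≤ ℓ ∧ ℓ ≤ 2 * t ∧
    q.1 = H'.pEdges i ℓ ∧ q.2 = H'.pEnds i ℓ) ∧
  (∀ q ∈ Q, ∀ q' ∈ Q, q ≠ q' → Disjoint (eVerts q.1) (eVerts q'.1)) ∧
  splitInt H t I = (Q.biUnion fun q => eVerts q.1) \ (Q.biUnion fun q => q.2) ∧
  H.cedges.filter (fun e => e ⊆ G.verts \ splitInt H t I) =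
    H'.cedges.filter (fun e =>
      e ⊆ G.verts \ ((Q.biUnion fun q => eVerts q.1) \ (Q.biUnion fun q => q.2))) ∧
  ∀ q ∈ Q, (H.pVerts i₀ t ∩ eVerts q.1).card ≤ 1

/-- A feasible `(P₀,H)`-switching: additionally `F' = H'[V(𝒫') ∖ V(P₀)]` is rainbow and
no edge of `F'` shares a colour with an edge of `H[V(G) ∖ V^I(𝒫)]`. -/
def IsFeasibleSwitching (χ : Finset ℕ → ℕ) (t m : ℕ) (H : LooseHamCycle k G)
    (i₀ : ℕ) (I : Finset ℕ) (H' : LooseHamCycle k G)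
    (Q : Finset (Finset (Finset ℕ) × Finset ℕ)) : Prop :=
  IsSwitching t m H i₀ I H' Q ∧
  RainbowEdges χ (H'.cedges.filter fun e =>
    e ⊆ (Q.biUnion fun q => eVerts q.1) \ H.pVerts i₀ t) ∧
  ∀ e ∈ H'.cedges.filter (fun e =>
      e ⊆ (Q.biUnion fun q => eVerts q.1) \ H.pVerts i₀ t),
    ∀ f ∈ H.cedges.filter (fun f => f ⊆ G.verts \ splitInt H t I), χ e ≠ χ f

/-- Two vertices are close (with respect to `H` and `t`) if they lie in edges of `H`
both contained in a loose path of `H` of length at most `2t+1`. -/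
def Close (H : LooseHamCycle k G) (t : ℕ) (u v : ℕ) : Prop :=
  ∃ i < numE G, ∃ i' < numE G, u ∈ H.cedge i ∧ v ∈ H.cedge i' ∧
    ∃ d ≤ 2 * t, (i + d) % numE G = i' ∨ (i' + d) % numE G = i

/-- A vertex set is spread if no two of its vertices are close. -/
def SpreadSet (H : LooseHamCycle k G) (t : ℕ) (S : Finset ℕ) : Prop :=
  ∀ u ∈ S, ∀ v ∈ S, u ≠ v → ¬ Close H t u v

/-- A vertex set is almost spread if exactly one pair of its vertices is close. -/
def AlmostSpreadSet (H : LooseHamCycle k G) (t : ℕ) (S : Finset ℕ) : Prop :=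
  ∃ u ∈ S, ∃ v ∈ S, u ≠ v ∧ Close H t u v ∧
    ∀ u' ∈ S, ∀ v' ∈ S, u' ≠ v' → Close H t u' v' → ({u', v'} : Finset ℕ) = {u, v}

end Splittings

/-- The probability that a `p`-random subset of `Finset.range N` (each element included
independently with probability `p`) satisfies `A`. -/
noncomputable def probOver (N : ℕ) (p : ℝ) (A : Finset ℕ → Prop) : ℝ :=
  ∑ S ∈ (Finset.range N).powerset,
    if A S then p ^ S.card * (1 - p) ^ (N - S.card) else 0

/-- A loose path of length `t` in `G`, recorded by an ordering of its vertices. -/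
structure LoosePath (k t : ℕ) (G : HGraph k) where
  σ : ℕ → ℕ
  injOn : Set.InjOn σ (Set.Iio (t * (k - 1) + 1))
  mem_verts : ∀ r < t * (k - 1) + 1, σ r ∈ G.verts
  edges_mem : ∀ i < t, (Finset.range k).image (fun r => σ (i * (k - 1) + r)) ∈ G.edges

namespace LoosePath

variable {k t : ℕ} {G : HGraph k}

/-- The vertex set of a loose path. -/
def verts (P : LoosePath k t G) : Finset ℕ := (Finset.range (t * (k - 1) + 1)).image P.σ

/-- The edge set of a loose path. -/
def edgeSet (P : LoosePath k t G) : Finset (Finset ℕ) :=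
  (Finset.range t).image fun i => (Finset.range k).image fun r => P.σ (i * (k - 1) + r)

/-- The first endvertex of a loose path. -/
def endA (P : LoosePath k t G) : ℕ := P.σ 0

/-- The last endvertex of a loose path. -/
def endB (P : LoosePath k t G) : ℕ := P.σ (t * (k - 1))

end LoosePath

lemma aux_exp_le (x c l : ℝ) (hc : 0 < c) (hx : |x| ≤ c) :
    Real.exp (l * x) ≤ Real.cosh (l * c) + x / c * Real.sinh (l * c) := by
  have hcv := convexOn_exp.2
  have h := @hcv (l * c) (Set.mem_univ (l * c)) (-(l * c)) (Set.mem_univ (-(l * c)))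
    ((1 + x / c) / 2) ((1 - x / c) / 2) ?_ ?_ (by ring)
  · simp only [smul_eq_mul] at h
    rw [Real.cosh_eq, Real.sinh_eq]
    have e : (1 + x / c) / 2 * (l * c) + (1 - x / c) / 2 * -(l * c) = l * x := by
      field_simp; ring
    rw [e] at h
    linarith
  · have := (abs_le.1 hx).1
    have : -1 ≤ x / c := by rw [le_div_iff₀ hc]; linarith
    linarith
  · have := (abs_le.1 hx).2
    have : x / c ≤ 1 := by rw [div_le_iff₀ hc]; linarith
    linarith

lemma aux_one_var {Ω : Type} [Fintype Ω] [Nonempty Ω] (F : Ω → ℝ) (c l : ℝ) (hc : 0 < c)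
    (hF : ∀ a b, |F a - F b| ≤ c) :
    ∑ a, Real.exp (l * F a) ≤ (Fintype.card Ω : ℝ) *
      Real.exp (l * ((∑ a, F a) / Fintype.card Ω) + l ^ 2 * c ^ 2 / 2) := by
  have hcard : (0 : ℝ) < Fintype.card Ω := by exact_mod_cast Fintype.card_pos
  set A := (∑ a, F a) / (Fintype.card Ω : ℝ) with hA
  have hdev : ∀ a, |F a - A| ≤ c := by
    intro a
    have : F a - A = (∑ b, (F a - F b)) / Fintype.card Ω := by
      rw [Finset.sum_sub_distrib, hA]; simp; field_simp
    rw [this, abs_div, abs_of_pos hcard, div_le_iff₀ hcard]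
    calc |∑ b, (F a - F b)| ≤ ∑ b, |F a - F b| := Finset.abs_sum_le_sum_abs _ _
      _ ≤ ∑ b : Ω, c := Finset.sum_le_sum fun b _ => hF a b
      _ = c * Fintype.card Ω := by simp [mul_comm]
  have hzero : ∑ a, (F a - A) = 0 := by
    rw [Finset.sum_sub_distrib, hA]; simp; field_simp; simp
  have h1 : ∑ a, Real.exp (l * (F a - A)) ≤ (Fintype.card Ω : ℝ) * Real.cosh (l * c) := by
    calc ∑ a, Real.exp (l * (F a - A))
        ≤ ∑ a, (Real.cosh (l * c) + (F a - A) / c * Real.sinh (l * c)) :=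
          Finset.sum_le_sum fun a _ => aux_exp_le _ _ _ hc (hdev a)
      _ = _ := by
          rw [Finset.sum_add_distrib, ← Finset.sum_mul, ← Finset.sum_div, hzero]; simp
  have h2 : ∑ a, Real.exp (l * F a) = Real.exp (l * A) * ∑ a, Real.exp (l * (F a - A)) := by
    rw [Finset.mul_sum]
    refine Finset.sum_congr rfl fun a _ => ?_
    rw [← Real.exp_add]; congr 1; ring
  rw [h2, Real.exp_add]
  have h3 : Real.cosh (l * c) ≤ Real.exp (l ^ 2 * c ^ 2 / 2) := by
    have := Real.cosh_le_exp_half_sq (l * c)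
    rwa [mul_pow] at this
  have := Real.exp_pos (l * A)
  calc _ ≤ Real.exp (l * A) * ((Fintype.card Ω : ℝ) * Real.exp (l ^ 2 * c ^ 2 / 2)) := by
        gcongr
        exact h1.trans (by gcongr)
    _ = _ := by ring

lemma aux_mgf {Ω : Type} [Fintype Ω] [Nonempty Ω] (c l : ℝ) (hc : 0 < c) (m : ℕ) :
    ∀ f : (Fin m → Ω) → ℝ, (∀ Y s a, |f (Function.update Y s a) - f Y| ≤ c) →
    ∑ Y, Real.exp (l * f Y) ≤ (Fintype.card Ω : ℝ) ^ m *
      Real.exp (l * ((∑ Y, f Y) / (Fintype.card Ω : ℝ) ^ m) + l ^ 2 * c ^ 2 * m / 2) := by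
  have hcard : (0 : ℝ) < Fintype.card Ω := by exact_mod_cast Fintype.card_pos
  induction m with
  | zero => intro f _; simp
  | succ m ih =>
    intro f hf
    have hs : ∀ g : (Fin (m+1) → Ω) → ℝ, ∑ Y, g Y = ∑ a : Ω, ∑ Y : Fin m → Ω, g (Fin.cons a Y) := by
      intro g
      rw [← Fintype.sum_prod_type' (fun a Y => g (Fin.cons a Y))]
      exact (Fintype.sum_equiv (Fin.consEquiv (fun _ => Ω)) _ _ (fun x => rfl)).symm
    rw [hs, hs]
    set F : Ω → ℝ := fun a => (∑ Y : Fin m → Ω, f (Fin.cons a Y)) / (Fintype.card Ω : ℝ) ^ m with hFdef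
    have hF : ∀ a b, |F a - F b| ≤ c := by
      intro a b
      simp only [hFdef]
      rw [← sub_div, ← Finset.sum_sub_distrib, abs_div, abs_of_pos (pow_pos hcard m),
        div_le_iff₀ (pow_pos hcard m)]
      calc _ ≤ ∑ Y : Fin m → Ω, |f (Fin.cons a Y) - f (Fin.cons b Y)| := Finset.abs_sum_le_sum_abs _ _
        _ ≤ ∑ Y : Fin m → Ω, c := by
          refine Finset.sum_le_sum fun Y _ => ?_
          have := hf (Fin.cons b Y) 0 a
          rwa [Fin.update_cons_zero] at this
        _ = _ := by simp [mul_comm]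
    have hstep : ∀ a, ∑ Y : Fin m → Ω, Real.exp (l * f (Fin.cons a Y)) ≤
        (Fintype.card Ω : ℝ) ^ m * Real.exp (l * F a + l ^ 2 * c ^ 2 * m / 2) := by
      intro a
      refine ih (fun Y => f (Fin.cons a Y)) ?_
      intro Y s b
      have := hf (Fin.cons a Y) s.succ b
      rwa [← Fin.cons_update] at this
    calc _ ≤ ∑ a, (Fintype.card Ω : ℝ) ^ m * Real.exp (l * F a + l ^ 2 * c ^ 2 * m / 2) :=
          Finset.sum_le_sum fun a _ => hstep a
      _ = (Fintype.card Ω : ℝ) ^ m * Real.exp (l ^ 2 * c ^ 2 * m / 2) * ∑ a, Real.exp (l * F a) := by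
          rw [Finset.mul_sum]
          refine Finset.sum_congr rfl fun a _ => ?_
          rw [Real.exp_add]; ring
      _ ≤ (Fintype.card Ω : ℝ) ^ m * Real.exp (l ^ 2 * c ^ 2 * m / 2) * ((Fintype.card Ω : ℝ) *
            Real.exp (l * ((∑ a, F a) / Fintype.card Ω) + l ^ 2 * c ^ 2 / 2)) := by
          have := aux_one_var F c l hc hF
          gcongr
      _ = _ := by
          have e : (∑ a, F a) / (Fintype.card Ω : ℝ) = (∑ a : Ω, ∑ Y : Fin m → Ω, f (Fin.cons a Y)) / (Fintype.card Ω : ℝ) ^ (m+1) := by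
            simp only [hFdef]
            rw [← Finset.sum_div, div_div, pow_succ]
          rw [e, pow_succ (Fintype.card Ω : ℝ) m]
          rw [show ∀ x y z w : ℝ, x * Real.exp y * (z * Real.exp w) = x * z * (Real.exp y * Real.exp w) by intros; ring, ← Real.exp_add]
          congr 2
          push_cast; ring

lemma aux_mcdiarmid {Ω : Type} [Fintype Ω] [Nonempty Ω] (c a : ℝ) (hc : 0 < c) (ha : 0 < a) (m : ℕ)
    (hm : 0 < m) (f : (Fin m → Ω) → ℝ) (hf : ∀ Y s a, |f (Function.update Y s a) - f Y| ≤ c) :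
    (((Finset.univ.filter fun Y => f Y ≤ (∑ Y, f Y) / (Fintype.card Ω : ℝ) ^ m - a).card : ℝ)) ≤
      (Fintype.card Ω : ℝ) ^ m * Real.exp (-(a ^ 2 / (2 * c ^ 2 * m))) := by
  have hm' : (0 : ℝ) < m := by exact_mod_cast hm
  set l : ℝ := -(a / (c ^ 2 * m)) with hl
  have hlneg : l ≤ 0 := by rw [hl]; exact neg_nonpos.2 (by positivity)
  set A := (∑ Y, f Y) / (Fintype.card Ω : ℝ) ^ m with hA
  have h := aux_mgf c l hc m f hf
  have h2 : (((Finset.univ.filter fun Y => f Y ≤ A - a).card : ℝ)) * Real.exp (l * (A - a)) ≤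
      ∑ Y, Real.exp (l * f Y) := by
    rw [← nsmul_eq_mul, ← Finset.sum_const]
    calc _ ≤ ∑ Y ∈ (Finset.univ.filter fun Y => f Y ≤ A - a), Real.exp (l * f Y) := by
          refine Finset.sum_le_sum fun Y hY => ?_
          rw [Finset.mem_filter] at hY
          exact Real.exp_le_exp.2 (mul_le_mul_of_nonpos_left hY.2 hlneg)
      _ ≤ _ := Finset.sum_le_univ_sum_of_nonneg fun Y => (Real.exp_pos _).le
  have h3 := h2.trans h
  have h4 : (((Finset.univ.filter fun Y => f Y ≤ A - a).card : ℝ)) ≤ (Fintype.card Ω : ℝ) ^ m *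
      Real.exp (l * A + l ^ 2 * c ^ 2 * m / 2) / Real.exp (l * (A - a)) := by
    rwa [le_div_iff₀ (Real.exp_pos _)]
  rw [mul_div_assoc, ← Real.exp_sub] at h4
  refine h4.trans (le_of_eq ?_)
  congr 2
  rw [hl]; field_simp; ring

/-- union bound for hits -/
lemma aux_hits {Ω : Type} [Fintype Ω] [Nonempty Ω] (m q K : ℕ) (S : Finset (Fin m))
    (D : Fin m → Finset Ω) (hD : ∀ s ∈ S, (D s).card ≤ K) :
    (((Finset.univ.filter fun Y : Fin m → Ω => q ≤ (S.filter fun s => Y s ∈ D s).card).card : ℝ)) ≤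
      2 ^ m * ((K : ℝ) / Fintype.card Ω) ^ q * (Fintype.card Ω : ℝ) ^ m := by
  have hcard : (0 : ℝ) < Fintype.card Ω := by exact_mod_cast Fintype.card_pos
  have hsub : (Finset.univ.filter fun Y : Fin m → Ω => q ≤ (S.filter fun s => Y s ∈ D s).card) ⊆
      (S.powersetCard q).biUnion fun Q => Fintype.piFinset fun s => if s ∈ Q then D s else univ := by
    intro Y hY
    rw [Finset.mem_filter] at hY
    obtain ⟨Q, hQ, hQc⟩ := Finset.exists_subset_card_eq hY.2
    rw [Finset.mem_biUnion]
    refine ⟨Q, Finset.mem_powersetCard.2 ⟨hQ.trans (Finset.filter_subset _ _), hQc⟩, ?_⟩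
    rw [Fintype.mem_piFinset]
    intro s
    split_ifs with hs
    · exact (Finset.mem_filter.1 (hQ hs)).2
    · exact Finset.mem_univ _
  have hone : ∀ Q ∈ S.powersetCard q, ((Fintype.piFinset fun s => if s ∈ Q then D s else univ).card : ℝ) ≤
      ((K : ℝ) / Fintype.card Ω) ^ q * (Fintype.card Ω : ℝ) ^ m := by
    intro Q hQ
    rw [Finset.mem_powersetCard] at hQ
    rw [Fintype.card_piFinset]
    push_cast
    have : ∀ s, (((if s ∈ Q then D s else univ : Finset Ω).card : ℝ)) ≤
        (if s ∈ Q then (K : ℝ) / Fintype.card Ω else 1) * Fintype.card Ω := by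
      intro s
      split_ifs with hs
      · rw [div_mul_cancel₀ _ hcard.ne']
        exact_mod_cast hD s (hQ.1 hs)
      · simp
    calc _ ≤ ∏ s : Fin m, ((if s ∈ Q then (K : ℝ) / Fintype.card Ω else 1) * Fintype.card Ω) :=
          Finset.prod_le_prod (fun _ _ => by positivity) fun s _ => this s
      _ = _ := by
          rw [Finset.prod_mul_distrib]
          simp [hQ.2, div_pow]
  have hle : ((S.powersetCard q).card : ℝ) ≤ 2 ^ m := by
    have : (S.powersetCard q).card ≤ 2 ^ m := by
      calc _ ≤ S.powerset.card := Finset.card_le_card fun x hx => by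
            rw [Finset.mem_powersetCard] at hx; exact Finset.mem_powerset.2 hx.1
        _ = 2 ^ S.card := Finset.card_powerset _
        _ ≤ 2 ^ m := Nat.pow_le_pow_right (by norm_num) (by simpa using Finset.card_le_univ S)
    exact_mod_cast this
  calc _ ≤ (((S.powersetCard q).biUnion fun Q => Fintype.piFinset fun s => if s ∈ Q then D s else univ).card : ℝ) := by
        exact_mod_cast Finset.card_le_card hsub
    _ ≤ ∑ Q ∈ S.powersetCard q, ((Fintype.piFinset fun s => if s ∈ Q then D s else univ).card : ℝ) := by
        exact_mod_cast Finset.card_biUnion_le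
    _ ≤ ∑ Q ∈ S.powersetCard q, ((K : ℝ) / Fintype.card Ω) ^ q * (Fintype.card Ω : ℝ) ^ m :=
        Finset.sum_le_sum hone
    _ = ((S.powersetCard q).card : ℝ) * (((K : ℝ) / Fintype.card Ω) ^ q * (Fintype.card Ω : ℝ) ^ m) := by
        simp
    _ ≤ 2 ^ m * (((K : ℝ) / Fintype.card Ω) ^ q * (Fintype.card Ω : ℝ) ^ m) := by gcongr
    _ = _ := by ring

/-- the counting function -/
def gcount {Ω : Type} {m : ℕ} (x : Fin m → Ω → ℕ) (blk : ℕ → Fin m) (Fam : Finset (Finset ℕ))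
    (Y : Fin m → Ω) : ℕ :=
  (Fam.filter fun F => ∀ v ∈ F, x (blk v) (Y (blk v)) = v).card

lemma gcount_diff {Ω : Type} {m : ℕ} (x : Fin m → Ω → ℕ) (blk : ℕ → Fin m)
    (Fam : Finset (Finset ℕ)) (q : ℕ) (hF : ∀ F ∈ Fam, F.card = q)
    (Y Y' : Fin m → Ω) (s : Fin m) (h : ∀ s', s' ≠ s → Y s' = Y' s') :
    gcount x blk Fam Y ≤ gcount x blk Fam Y' + m ^ (q - 1) := by
  unfold gcount
  set W : Finset ℕ := univ.image fun s => x s (Y s) with hW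
  have hWc : W.card ≤ m := by
    calc _ ≤ (univ : Finset (Fin m)).card := Finset.card_image_le
      _ = m := by simp
  have hsub : (Fam.filter fun F => ∀ v ∈ F, x (blk v) (Y (blk v)) = v) ⊆
      (Fam.filter fun F => ∀ v ∈ F, x (blk v) (Y' (blk v)) = v) ∪
      (W.powersetCard (q-1)).image (fun A => insert (x s (Y s)) A) := by
    intro F hFm
    rw [Finset.mem_filter] at hFm
    rw [Finset.mem_union]
    by_cases hs : ∃ v ∈ F, blk v = s
    · right
      obtain ⟨v, hv, hvs⟩ := hs
      have hxv := hFm.2 v hv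
      rw [hvs] at hxv
      rw [Finset.mem_image]
      refine ⟨F.erase v, ?_, ?_⟩
      · rw [Finset.mem_powersetCard]
        refine ⟨?_, ?_⟩
        · intro w hw
          rw [hW, Finset.mem_image]
          exact ⟨blk w, Finset.mem_univ _, hFm.2 w (Finset.mem_of_mem_erase hw)⟩
        · rw [Finset.card_erase_of_mem hv, hF F hFm.1]
      · rw [hxv, Finset.insert_erase hv]
    · left
      push Not at hs
      rw [Finset.mem_filter]
      refine ⟨hFm.1, fun v hv => ?_⟩
      rw [← h _ (hs v hv)]
      exact hFm.2 v hv
  calc _ ≤ _ := Finset.card_le_card hsub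
    _ ≤ _ := Finset.card_union_le _ _
    _ ≤ _ := by
      gcongr
      calc _ ≤ (W.powersetCard (q-1)).card := Finset.card_image_le
        _ = W.card.choose (q-1) := Finset.card_powersetCard _ _
        _ ≤ W.card ^ (q-1) := Nat.choose_le_pow _ _
        _ ≤ _ := Nat.pow_le_pow_left hWc _

lemma gcount_mean {Ω : Type} [Fintype Ω] [Nonempty Ω] {m : ℕ} (x : Fin m → Ω → ℕ) (blk : ℕ → Fin m)
    (Fam : Finset (Finset ℕ)) (q a : ℕ) (hF : ∀ F ∈ Fam, F.card = q)
    (hinj : ∀ F ∈ Fam, Set.InjOn blk F)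
    (ha : ∀ F ∈ Fam, ∀ v ∈ F, a ≤ (univ.filter fun ω => x (blk v) ω = v).card) :
    (Fam.card : ℝ) * ((a : ℝ) / Fintype.card Ω) ^ q ≤
      (∑ Y : Fin m → Ω, (gcount x blk Fam Y : ℝ)) / (Fintype.card Ω : ℝ) ^ m := by
  have hcard : (0 : ℝ) < Fintype.card Ω := by exact_mod_cast Fintype.card_pos
  rw [le_div_iff₀ (pow_pos hcard m)]
  have h1 : ∑ Y : Fin m → Ω, (gcount x blk Fam Y : ℝ) =
      ∑ F ∈ Fam, ((univ.filter fun Y : Fin m → Ω => ∀ v ∈ F, x (blk v) (Y (blk v)) = v).card : ℝ) := by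
    unfold gcount
    simp only [Finset.card_filter]
    push_cast
    rw [Finset.sum_comm]
  rw [h1, mul_assoc, ← nsmul_eq_mul, ← Finset.sum_const]
  refine Finset.sum_le_sum fun F hFm => ?_
  have hset : (univ.filter fun Y : Fin m → Ω => ∀ v ∈ F, x (blk v) (Y (blk v)) = v) =
      Fintype.piFinset fun s => univ.filter fun ω => ∀ v ∈ F, blk v = s → x s ω = v := by
    ext Y
    simp only [Finset.mem_filter, Finset.mem_univ, true_and, Fintype.mem_piFinset]
    constructor
    · rintro h s v hv rfl
      exact h v hv
    · intro h v hv
      exact h _ v hv rfl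
  rw [hset, Fintype.card_piFinset]
  push_cast
  have hs : ∀ s : Fin m, (if s ∈ F.image blk then (a : ℝ) / Fintype.card Ω else 1) * Fintype.card Ω ≤
      (((univ.filter fun ω => ∀ v ∈ F, blk v = s → x s ω = v) : Finset Ω).card : ℝ) := by
    intro s
    split_ifs with h
    · rw [div_mul_cancel₀ _ hcard.ne']
      obtain ⟨v, hv, rfl⟩ := Finset.mem_image.1 h
      have := ha F hFm v hv
      refine (Nat.cast_le.2 this).trans ?_
      refine Nat.cast_le.2 (Finset.card_le_card ?_)
      intro ω hω
      simp only [Finset.mem_filter, Finset.mem_univ, true_and] at hω ⊢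
      intro w hw hwv
      have := hinj F hFm hw hv hwv
      subst this
      exact hω
    · rw [one_mul]
      refine le_of_eq ?_
      rw [Finset.filter_true_of_mem]
      · simp
      · intro ω _ v hv hvs
        exact absurd (Finset.mem_image.2 ⟨v, hv, hvs⟩) h
  calc _ = ∏ s : Fin m, ((if s ∈ F.image blk then (a : ℝ) / Fintype.card Ω else 1) * Fintype.card Ω) := by
        rw [Finset.prod_mul_distrib, Finset.prod_ite_mem, Finset.univ_inter, Finset.prod_const,
          Finset.card_image_of_injOn (hinj F hFm), hF F hFm]
        simp
    _ ≤ _ := Finset.prod_le_prod (fun _ _ => by positivity) fun s _ => hs s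

lemma gcount_tail {Ω : Type} [Fintype Ω] [Nonempty Ω] {m : ℕ} (hm : 0 < m) (x : Fin m → Ω → ℕ)
    (blk : ℕ → Fin m)
    (Fam : Finset (Finset ℕ)) (q a : ℕ) (hq : 1 ≤ q) (hF : ∀ F ∈ Fam, F.card = q)
    (hinj : ∀ F ∈ Fam, Set.InjOn blk F)
    (ha : ∀ F ∈ Fam, ∀ v ∈ F, a ≤ (univ.filter fun ω => x (blk v) ω = v).card)
    (η θ : ℝ) (hη : 0 < η)
    (hθ : θ + η * (m : ℝ) ^ q ≤ (Fam.card : ℝ) * ((a : ℝ) / Fintype.card Ω) ^ q) :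
    ((univ.filter fun Y : Fin m → Ω => (gcount x blk Fam Y : ℝ) < θ).card : ℝ) ≤
      (Fintype.card Ω : ℝ) ^ m * Real.exp (-(η ^ 2 * m / 2)) := by
  have hm' : (0 : ℝ) < m := by exact_mod_cast hm
  have hmean := gcount_mean x blk Fam q a hF hinj ha
  have hmc := aux_mcdiarmid (Ω := Ω) ((m : ℝ) ^ (q-1)) (η * (m : ℝ) ^ q) (by positivity) (by positivity) m hm
    (fun Y => (gcount x blk Fam Y : ℝ)) (by
      intro Y s ω
      have h1 := gcount_diff x blk Fam q hF (Function.update Y s ω) Y s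
        (fun s' hs' => Function.update_of_ne hs' _ _)
      have h2 := gcount_diff x blk Fam q hF Y (Function.update Y s ω) s
        (fun s' hs' => (Function.update_of_ne hs' _ _).symm)
      rw [abs_le]
      have h1' : (gcount x blk Fam (Function.update Y s ω) : ℝ) ≤ gcount x blk Fam Y + (m:ℝ) ^ (q-1) := by exact_mod_cast h1
      have h2' : (gcount x blk Fam Y : ℝ) ≤ gcount x blk Fam (Function.update Y s ω) + (m:ℝ) ^ (q-1) := by exact_mod_cast h2
      constructor <;> linarith)
  have e : (η * (m : ℝ) ^ q) ^ 2 / (2 * ((m : ℝ) ^ (q-1)) ^ 2 * m) = η ^ 2 * m / 2 := by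
    obtain ⟨p, rfl⟩ : ∃ p, q = p + 1 := ⟨q - 1, by omega⟩
    simp only [Nat.add_sub_cancel]
    field_simp
    ring
  rw [e] at hmc
  refine le_trans ?_ hmc
  refine Nat.cast_le.2 (Finset.card_le_card ?_)
  intro Y hY
  simp only [Finset.mem_filter, Finset.mem_univ, true_and] at hY ⊢
  linarith

/-- swapping trick: conditioning on the coordinates in `J`. -/
lemma swap_count {Ω : Type} [Fintype Ω] [Nonempty Ω] {m : ℕ} (J : Finset (Fin m))
    (R : (Fin m → Ω) → (Fin m → Ω) → Prop)
    (hR : ∀ y y' Y Y', (∀ s ∈ J, y s = y' s) → (∀ s, s ∉ J → Y s = Y' s) → (R y Y ↔ R y' Y'))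
    (δ : ℝ)
    (h : ∀ y, ((univ.filter fun Y : Fin m → Ω => R y Y).card : ℝ) ≤ (Fintype.card Ω : ℝ) ^ m * δ) :
    ((univ.filter fun Y : Fin m → Ω => R Y Y).card : ℝ) ≤ (Fintype.card Ω : ℝ) ^ m * δ := by
  have hcard : (0 : ℝ) < (Fintype.card Ω : ℝ) ^ m := by
    have : (0 : ℝ) < Fintype.card Ω := by exact_mod_cast Fintype.card_pos
    positivity
  let mix : (Fin m → Ω) → (Fin m → Ω) → (Fin m → Ω) := fun y Y s => if s ∈ J then y s else Y s
  have h1 : ∑ y : Fin m → Ω, ∑ Y : Fin m → Ω, (if R y Y then (1:ℝ) else 0) ≤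
      (Fintype.card Ω : ℝ) ^ m * ((Fintype.card Ω : ℝ) ^ m * δ) := by
    calc _ ≤ ∑ y : Fin m → Ω, (Fintype.card Ω : ℝ) ^ m * δ := by
          refine Finset.sum_le_sum fun y _ => ?_
          have := h y
          rw [Finset.card_filter] at this
          push_cast at this
          exact this
      _ = _ := by simp
  have h2 : ∑ y : Fin m → Ω, ∑ Y : Fin m → Ω, (if R y Y then (1:ℝ) else 0) =
      ∑ y : Fin m → Ω, ∑ Y : Fin m → Ω, (if R Y Y then (1:ℝ) else 0) := by
    rw [← Fintype.sum_prod_type' (fun y Y => if R y Y then (1:ℝ) else 0),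
      ← Fintype.sum_prod_type' (fun y Y => if R Y Y then (1:ℝ) else 0)]
    have hinv : Function.Involutive (fun p : (Fin m → Ω) × (Fin m → Ω) => (mix p.2 p.1, mix p.1 p.2)) := by
      rintro ⟨y, Y⟩
      simp only [mix, Prod.mk.injEq]
      constructor <;> · funext s; split_ifs <;> rfl
    refine Fintype.sum_equiv hinv.toPerm _ _ ?_
    rintro ⟨y, Y⟩
    have : R y Y ↔ R (mix y Y) (mix y Y) := by
      apply hR
      · intro s hs; simp [mix, hs]
      · intro s hs; simp [mix, hs]
    change (if R y Y then (1:ℝ) else 0) = if R (mix y Y) (mix y Y) then (1:ℝ) else 0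
    by_cases hh : R y Y
    · rw [if_pos hh, if_pos (this.1 hh)]
    · rw [if_neg hh, if_neg (fun h' => hh (this.2 h'))]
  rw [h2] at h1
  simp only [Finset.sum_const, nsmul_eq_mul] at h1
  have e : ((univ : Finset (Fin m → Ω)).card : ℝ) = (Fintype.card Ω : ℝ) ^ m := by simp
  rw [e] at h1
  have := le_of_mul_le_mul_left h1 hcard
  rw [Finset.card_filter]
  push_cast
  exact this

/-- A configuration of `m` paths of `H`, the `s`-th path with index `J s` and vertices `P s r`. -/
structure PathCfg {k : ℕ} {G : HGraph k} (H : LooseHamCycle k G) (t m : ℕ) where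
  J : ℕ → ℕ
  P : ℕ → ℕ → ℕ
  hP : ∀ s < m, H.pVerts (J s) t = (Finset.range (TOf k t)).image (P s)
  hA : ∀ s < m, H.pEndA (J s) = P s 0
  hB : ∀ s < m, H.pEndB (J s) t = P s (TOf k t - 1)
  hinj : ∀ s < m, ∀ r < TOf k t, ∀ s' < m, ∀ r' < TOf k t, P s r = P s' r' → s = s' ∧ r = r'
  hN : ∀ s < m, J s < numE G
  hnext : ∀ s < m, nextIdx ((Finset.range m).image J) (J s) = J ((s + 1) % m)

namespace PathCfg
variable {k t m : ℕ} {G : HGraph k} {H : LooseHamCycle k G} (C : PathCfg H t m)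

def I : Finset ℕ := (Finset.range m).image C.J

lemma T_pos : 0 < TOf k t := by unfold TOf; omega

include C in
lemma J_inj {s s' : ℕ} (hs : s < m) (hs' : s' < m) (h : C.J s = C.J s') : s = s' := by
  have h1 := C.hA s hs
  rw [h, C.hA s' hs'] at h1
  exact (C.hinj s' hs' 0 T_pos s hs 0 T_pos h1).1.symm

lemma mem_I {i : ℕ} : i ∈ C.I ↔ ∃ s < m, C.J s = i := by
  simp [I]

lemma card_I : C.I.card = m := by
  rw [I, Finset.card_image_of_injOn, Finset.card_range]
  intro s hs s' hs' h
  exact C.J_inj (by simpa using hs) (by simpa using hs') h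

lemma mem_pV {s v : ℕ} (hs : s < m) : v ∈ H.pVerts (C.J s) t ↔ ∃ r < TOf k t, C.P s r = v := by
  rw [C.hP s hs]; simp

lemma pV_unique {s s' v : ℕ} (hs : s < m) (hs' : s' < m) (h : v ∈ H.pVerts (C.J s) t)
    (h' : v ∈ H.pVerts (C.J s') t) : s = s' := by
  obtain ⟨r, hr, rfl⟩ := (C.mem_pV hs).1 h
  obtain ⟨r', hr', e⟩ := (C.mem_pV hs').1 h'
  exact (C.hinj s' hs' r' hr' s hs r hr e).1.symm

lemma isSplitting : IsSplitting H t C.I := by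
  refine ⟨fun i hi => ?_, fun i hi i' hi' hne => ?_⟩
  · obtain ⟨s, hs, rfl⟩ := C.mem_I.1 hi
    exact C.hN s hs
  · obtain ⟨s, hs, rfl⟩ := C.mem_I.1 hi
    obtain ⟨s', hs', rfl⟩ := C.mem_I.1 hi'
    rw [Finset.disjoint_left]
    intro v hv hv'
    exact hne (by rw [C.pV_unique hs hs' hv hv'])

lemma mem_splitVerts {v : ℕ} : v ∈ splitVerts H t C.I ↔ ∃ s < m, ∃ r < TOf k t, C.P s r = v := by
  unfold splitVerts
  rw [Finset.mem_biUnion]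
  constructor
  · rintro ⟨i, hi, hv⟩
    obtain ⟨s, hs, rfl⟩ := C.mem_I.1 hi
    exact ⟨s, hs, (C.mem_pV hs).1 hv⟩
  · rintro ⟨s, hs, h⟩
    exact ⟨C.J s, C.mem_I.2 ⟨s, hs, rfl⟩, (C.mem_pV hs).2 h⟩

lemma mem_splitEnds {v : ℕ} : v ∈ splitEnds H t C.I ↔
    ∃ s < m, C.P s 0 = v ∨ C.P s (TOf k t - 1) = v := by
  unfold splitEnds LooseHamCycle.pEnds
  rw [Finset.mem_biUnion]
  constructor
  · rintro ⟨i, hi, hv⟩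
    obtain ⟨s, hs, rfl⟩ := C.mem_I.1 hi
    refine ⟨s, hs, ?_⟩
    rw [C.hA s hs, C.hB s hs, Finset.mem_insert, Finset.mem_singleton] at hv
    tauto
  · rintro ⟨s, hs, h⟩
    refine ⟨C.J s, C.mem_I.2 ⟨s, hs, rfl⟩, ?_⟩
    rw [C.hA s hs, C.hB s hs, Finset.mem_insert, Finset.mem_singleton]
    tauto

/-- paths (other than path `0`) hit by `W` -/
def hit (W : Finset ℕ) : Finset ℕ :=
  (Finset.range m).filter fun s => s ≠ 0 ∧ (H.pVerts (C.J s) t ∩ W).Nonempty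

lemma card_hit_ge (hm : 0 < m) {e : Finset ℕ} (he : e ⊆ splitVerts H t C.I \ H.pVerts (C.J 0) t)
    (htr : Transverse H t C.I e) : e.card ≤ (C.hit e).card := by
  have : ∀ v ∈ e, ∃ s < m, v ∈ H.pVerts (C.J s) t := by
    intro v hv
    have := (Finset.mem_sdiff.1 (he hv)).1
    obtain ⟨s, hs, h⟩ := C.mem_splitVerts.1 this
    exact ⟨s, hs, (C.mem_pV hs).2 h⟩
  choose! f hf hf' using this
  refine Finset.card_le_card_of_injOn f ?_ ?_
  · intro v hv
    simp only [hit, Finset.coe_filter, Set.mem_setOf_eq, Finset.mem_range]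
    refine ⟨hf v hv, ?_, ⟨v, Finset.mem_inter.2 ⟨hf' v hv, hv⟩⟩⟩
    intro h0
    have := hf' v hv
    rw [h0] at this
    exact (Finset.mem_sdiff.1 (he hv)).2 this
  · intro v hv w hw hvw
    have h1 := htr (C.J (f v)) (C.mem_I.2 ⟨_, hf v hv, rfl⟩)
    rw [Finset.card_le_one] at h1
    refine h1 v (Finset.mem_inter.2 ⟨hv, hf' v hv⟩) w (Finset.mem_inter.2 ⟨hw, ?_⟩)
    have := hf' w hw
    change f v = f w at hvw
    rwa [hvw]

lemma hit_union (e f : Finset ℕ) : C.hit (e ∪ f) = C.hit e ∪ C.hit f := by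
  ext s
  simp only [hit, Finset.mem_filter, Finset.mem_union, Finset.inter_union_distrib_left,
    Finset.union_nonempty]
  tauto

lemma suitable (hm : 0 < m) (hk : 2 ≤ k) (χ : Finset ℕ → ℕ) (ε : ℝ)
    (hε : (k * TOf k t : ℝ) ≤ ε * m / 4)
    (h1 : ∀ e ∈ G.edges, (∃ f ∈ H.cedges, χ f = χ e) → (C.hit e).card < k)
    (h2 : ∀ e ∈ G.edges, ∀ f ∈ G.edges, χ e = χ f → (C.hit (e ∪ f)).card < 2 * k - 1) :
    Suitable χ ε m H t C.I (C.J 0) := by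
  refine ⟨?_, ?_, ?_⟩
  · intro S hS hSc hST
    refine le_trans ?_ hε
    set V0 : Finset ℕ := H.pVerts (C.J 0) t ∪
      S.biUnion (fun w => (C.I.filter fun i => w ∈ H.pVerts i t).biUnion fun i => H.pVerts i t) with hV0
    have hpc : ∀ s < m, (H.pVerts (C.J s) t).card ≤ TOf k t := by
      intro s hs
      rw [C.hP s hs]
      exact Finset.card_image_le.trans (by simp)
    have hV0c : V0.card ≤ k * TOf k t := by
      calc V0.card ≤ TOf k t + S.card * TOf k t := by
            refine (Finset.card_union_le _ _).trans (Nat.add_le_add (hpc 0 hm) ?_)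
            refine Finset.card_biUnion_le_card_mul _ _ _ fun w hw => ?_
            have hone : (C.I.filter fun i => w ∈ H.pVerts i t).card ≤ 1 := by
              rw [Finset.card_le_one]
              intro i hi i' hi'
              rw [Finset.mem_filter] at hi hi'
              obtain ⟨s, hs, rfl⟩ := C.mem_I.1 hi.1
              obtain ⟨s', hs', rfl⟩ := C.mem_I.1 hi'.1
              rw [C.pV_unique hs hs' hi.2 hi'.2]
            calc _ ≤ (C.I.filter fun i => w ∈ H.pVerts i t).card * TOf k t := by
                  refine Finset.card_biUnion_le_card_mul _ _ _ fun i hi => ?_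
                  obtain ⟨s, hs, rfl⟩ := C.mem_I.1 (Finset.mem_filter.1 hi).1
                  exact hpc s hs
              _ ≤ 1 * TOf k t := Nat.mul_le_mul_right _ hone
              _ = _ := one_mul _
        _ = _ := by
            rw [hSc]
            obtain ⟨p, rfl⟩ : ∃ p, k = p + 1 := ⟨k - 1, by omega⟩
            simp; ring
    have hsub : ((G.inducedEdges (splitVerts H t C.I)).filter
        fun e => S ⊆ e ∧ ∃ f ∈ H.cedges, χ f = χ e) ⊆ V0.image fun v => insert v S := by
      intro e he
      simp only [HGraph.inducedEdges, Finset.mem_filter] at he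
      obtain ⟨⟨heG, heV⟩, hSe, hcol⟩ := he
      have hec := G.edge_card e heG
      have hd : (e \ S).card = 1 := by
        rw [Finset.card_sdiff_of_subset hSe]; omega
      obtain ⟨v, hv⟩ := Finset.card_eq_one.1 hd
      have hve : v ∈ e \ S := by rw [hv]; exact Finset.mem_singleton_self v
      have hins : insert v S = e := by
        rw [← Finset.union_sdiff_of_subset hSe, hv, Finset.union_comm]; rfl
      refine Finset.mem_image.2 ⟨v, ?_, hins⟩
      by_contra hnot
      rw [hV0, Finset.mem_union, not_or] at hnot
      obtain ⟨hn0, hn1⟩ := hnot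
      have hTe : Transverse H t C.I e := by
        intro i hi
        by_cases hvi : v ∈ H.pVerts i t
        · have : S ∩ H.pVerts i t = ∅ := by
            by_contra hne
            obtain ⟨w, hw⟩ := Finset.nonempty_iff_ne_empty.2 hne
            rw [Finset.mem_inter] at hw
            apply hn1
            simp only [Finset.mem_biUnion, Finset.mem_filter]
            exact ⟨w, hw.1, i, ⟨hi, hw.2⟩, hvi⟩
          rw [← hins, Finset.insert_inter_of_mem hvi, this]
          simp
        · rw [← hins, Finset.insert_inter_of_notMem hvi]
          exact hST i hi
      have heV' : e ⊆ splitVerts H t C.I \ H.pVerts (C.J 0) t := by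
        rw [← hins]
        intro w hw
        rcases Finset.mem_insert.1 hw with rfl | hw
        · exact Finset.mem_sdiff.2 ⟨heV (Finset.mem_sdiff.1 hve).1, hn0⟩
        · exact hS hw
      have := C.card_hit_ge hm heV' hTe
      have := h1 e heG hcol
      omega
    calc _ ≤ ((V0.image fun v => insert v S).card : ℝ) := by exact_mod_cast Finset.card_le_card hsub
      _ ≤ (V0.card : ℝ) := by exact_mod_cast Finset.card_image_le
      _ ≤ _ := by exact_mod_cast hV0c
  · intro X hX hXT e he f hf hχ hef
    simp only [HGraph.inducedEdges, Finset.mem_filter] at he hf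
    have hu : e ∪ f ⊆ X := Finset.union_subset he.2 hf.2
    have htr : Transverse H t C.I (e ∪ f) := fun i hi =>
      (Finset.card_le_card (Finset.inter_subset_inter_right hu)).trans (hXT i hi)
    have h3 := C.card_hit_ge hm (hu.trans hX) htr
    have h4 := h2 e he.1 f hf.1 hχ
    have h5 := Finset.card_union_add_card_inter e f
    rw [G.edge_card e he.1, G.edge_card f hf.1] at h5
    omega
  · intro e he f hf hχ hd hTe hTf
    simp only [HGraph.inducedEdges, Finset.mem_filter] at he hf
    have h3 := C.card_hit_ge hm he.2 hTe
    have h4 := C.card_hit_ge hm hf.2 hTf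
    have h5 := h2 e he.1 f hf.1 hχ
    rw [hit_union] at h5
    have h6 := Finset.card_union_add_card_inter (C.hit e) (C.hit f)
    rw [G.edge_card e he.1] at h3
    rw [G.edge_card f hf.1] at h4
    have h7 : 1 < (C.hit e ∩ C.hit f).card := by omega
    obtain ⟨s, hs, s', hs', hne⟩ := Finset.one_lt_card.1 h7
    simp only [hit, Finset.mem_inter, Finset.mem_filter, Finset.mem_range] at hs hs'
    refine ⟨C.J s, C.mem_I.2 ⟨s, hs.1.1, rfl⟩, C.J s', C.mem_I.2 ⟨s', hs'.1.1, rfl⟩, ?_,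
      hs.1.2.2, hs.2.2.2, hs'.1.2.2, hs'.2.2.2⟩
    intro h
    exact hne (C.J_inj hs.1.1 hs'.1.1 h)

end PathCfg

lemma card_mod_eq (T q h : ℕ) (hh : h < T) :
    ((Finset.range (T * q)).filter fun s => s % T = h).card = q := by
  have : ((Finset.range (T * q)).filter fun s => s % T = h) = (Finset.range q).image fun x => T * x + h := by
    ext s
    simp only [Finset.mem_filter, Finset.mem_range, Finset.mem_image]
    constructor
    · rintro ⟨h1, h2⟩
      refine ⟨s / T, ?_, ?_⟩
      · exact Nat.div_lt_of_lt_mul h1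
      · rw [← h2]; exact Nat.div_add_mod s T
    · rintro ⟨x, hx, rfl⟩
      refine ⟨?_, ?_⟩
      · calc T * x + h < T * x + T := by omega
          _ = T * (x + 1) := by ring
          _ ≤ T * q := Nat.mul_le_mul_left _ hx
      · rw [Nat.mul_add_mod, Nat.mod_eq_of_lt hh]
  rw [this, Finset.card_image_of_injective, Finset.card_range]
  intro x y hxy
  have : T * x = T * y := by simpa using hxy
  exact Nat.eq_of_mul_eq_mul_left (by omega) this

namespace PathCfg
variable {k t m : ℕ} {G : HGraph k} {H : LooseHamCycle k G} (C : PathCfg H t m)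

/-- The parts. -/
def part (rr : ℕ → ℕ → ℕ) (h : ℕ) : Finset ℕ :=
  (Finset.range (m)).image fun s => C.P s (rr s h)

/-- The rerouting pairs. -/
def rpair (s : ℕ) : Finset ℕ := {C.P s 0, C.P ((s + (m - 2)) % m) (TOf k t - 1)}

lemma shift_mod {T m s : ℕ} (hT : 3 ≤ T) (hTm : T ∣ m) (hm : 0 < m) :
    ((s + (m - 2)) % m + 2) % T = s % T := by
  have hle := Nat.le_of_dvd hm hTm
  have h1 : ((s + (m - 2)) % m + 2) % m = s % m := by
    rw [Nat.mod_add_mod, show s + (m - 2) + 2 = s + m by omega, Nat.add_mod_right]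
  have h2 : _ % T = _ % T := congrArg (fun z => z % T) h1
  rwa [Nat.mod_mod_of_dvd _ hTm, Nat.mod_mod_of_dvd _ hTm] at h2

lemma viable (hmdef : m = mOf k t) (hT : 3 ≤ TOf k t) (ht : 0 < t) (rr : ℕ → ℕ → ℕ)
    (hlt : ∀ s < m, ∀ h < TOf k t, rr s h < TOf k t)
    (hinj : ∀ s < m, ∀ h < TOf k t, ∀ h' < TOf k t, rr s h = rr s h' → h = h')
    (h0 : ∀ s < m, rr s (s % TOf k t) = 0)
    (h2 : ∀ s < m, rr s ((s + 2) % TOf k t) = TOf k t - 1)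
    (j : ℕ) (ε : ℝ)
    (hdeg : ∀ h < TOf k t, G.MinDegOnGe j (C.part rr h)
      ((looseHamThreshold j k + ε / 2) * (mOf k t : ℝ) ^ (k - j))) :
    IsViablePartition j ε t H C.I (C.part rr) := by
  have hT0 : 0 < TOf k t := by omega
  have hm0 : 0 < m := by
    rw [hmdef]; unfold mOf mtOf TOf; positivity
  have hTm : TOf k t ∣ m := ⟨mtOf k t, hmdef⟩
  have hTlem := Nat.le_of_dvd hm0 hTm
  set T := TOf k t with hTdef
  have hmem : ∀ h v, v ∈ C.part rr h ↔ ∃ s < m, C.P s (rr s h) = v := by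
    intro h v; simp [part]
  -- surjectivity of rr
  have hsurj : ∀ s < m, ∀ r < T, ∃ h < T, rr s h = r := by
    intro s hs r hr
    have hsj := Finset.surj_on_of_inj_on_of_card_le (s := Finset.range T) (t := Finset.range T)
      (fun h _ => rr s h) (fun h hh => Finset.mem_range.2 (hlt s hs h (Finset.mem_range.1 hh)))
      (fun h h' hh hh' e => hinj s hs h (Finset.mem_range.1 hh) h' (Finset.mem_range.1 hh') e)
      le_rfl r (Finset.mem_range.2 hr)
    obtain ⟨h, hh, e⟩ := hsj
    exact ⟨h, Finset.mem_range.1 hh, e.symm⟩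
  have hdisj : ∀ h < T, ∀ h' < T, ∀ v, v ∈ C.part rr h → v ∈ C.part rr h' → h = h' := by
    intro h hh h' hh' v hv hv'
    obtain ⟨s, hs, rfl⟩ := (hmem h v).1 hv
    obtain ⟨s', hs', e⟩ := (hmem h' _).1 hv'
    obtain ⟨rfl, e2⟩ := C.hinj s' hs' _ (hlt s' hs' h' hh') s hs _ (hlt s hs h hh) e
    exact hinj s' hs' h hh h' hh' e2.symm
  have hpre : ∀ s < m, (s + (m - 2)) % m < m := fun s _ => Nat.mod_lt _ hm0
  have hA_mem : ∀ s < m, C.P s 0 ∈ C.part rr (s % T) := by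
    intro s hs
    exact (hmem _ _).2 ⟨s, hs, by rw [h0 s hs]⟩
  have hB_mem : ∀ s < m, C.P ((s + (m - 2)) % m) (T - 1) ∈ C.part rr (s % T) := by
    intro s hs
    refine (hmem _ _).2 ⟨(s + (m - 2)) % m, hpre s hs, ?_⟩
    have := h2 _ (hpre s hs)
    rw [shift_mod hT hTm hm0] at this
    rw [this]
  have hpair_sub : ∀ s < m, C.rpair s ⊆ C.part rr (s % T) := by
    intro s hs v hv
    rw [rpair, Finset.mem_insert, Finset.mem_singleton] at hv
    rcases hv with rfl | rfl
    · exact hA_mem s hs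
    · exact hB_mem s hs
  have hshift_inj : ∀ s < m, ∀ s' < m, (s + (m - 2)) % m = (s' + (m - 2)) % m → s = s' := by
    intro s hs s' hs' e
    have : s ≡ s' [MOD m] := Nat.ModEq.add_right_cancel' (m - 2) e
    rwa [Nat.ModEq, Nat.mod_eq_of_lt hs, Nat.mod_eq_of_lt hs'] at this
  have hpair_disj : ∀ s < m, ∀ s' < m, ∀ v, v ∈ C.rpair s → v ∈ C.rpair s' → s = s' := by
    intro s hs s' hs' v hv hv'
    rw [rpair, Finset.mem_insert, Finset.mem_singleton] at hv hv'
    rcases hv with rfl | rfl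
    · rcases hv' with e | e
      · exact (C.hinj s hs 0 hT0 s' hs' 0 hT0 e).1
      · have := (C.hinj s hs 0 hT0 _ (hpre s' hs') (T-1) (by omega) e).2
        omega
    · rcases hv' with e | e
      · have := (C.hinj _ (hpre s hs) (T-1) (by omega) s' hs' 0 hT0 e).2
        omega
      · exact hshift_inj s hs s' hs' (C.hinj _ (hpre s hs) (T-1) (by omega) _ (hpre s' hs') (T-1) (by omega) e).1
  have hrinj : ∀ s < m, ∀ s' < m, C.rpair s = C.rpair s' → s = s' := by
    intro s hs s' hs' e
    have hv : C.P s 0 ∈ C.rpair s := by rw [rpair]; exact Finset.mem_insert_self _ _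
    exact hpair_disj s hs s' hs' _ hv (e ▸ hv)
  refine ⟨?_, ?_, ?_, ?_, ?_⟩
  · ext v
    rw [Finset.mem_biUnion, C.mem_splitVerts]
    constructor
    · rintro ⟨h, hh, hv⟩
      rw [Finset.mem_range] at hh
      obtain ⟨s, hs, rfl⟩ := (hmem h v).1 hv
      exact ⟨s, hs, _, hlt s hs h hh, rfl⟩
    · rintro ⟨s, hs, r, hr, rfl⟩
      obtain ⟨h, hh, rfl⟩ := hsurj s hs r hr
      exact ⟨h, Finset.mem_range.2 hh, (hmem _ _).2 ⟨s, hs, rfl⟩⟩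
  · intro h hh h' hh' hne
    rw [Finset.disjoint_left]
    intro v hv hv'
    exact hne (hdisj h (Finset.mem_range.1 hh) h' (Finset.mem_range.1 hh') v hv hv')
  · intro h hh i hi
    rw [Finset.mem_range] at hh
    obtain ⟨s, hs, rfl⟩ := C.mem_I.1 hi
    rw [Finset.card_le_one]
    have key : ∀ v, v ∈ C.part rr h ∩ H.pVerts (C.J s) t → v = C.P s (rr s h) := by
      intro v hv
      rw [Finset.mem_inter] at hv
      obtain ⟨s', hs', rfl⟩ := (hmem _ _).1 hv.1
      obtain ⟨r, hr, e⟩ := (C.mem_pV hs).1 hv.2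
      obtain ⟨rfl, -⟩ := C.hinj s hs r hr s' hs' _ (hlt s' hs' h hh) e
      rfl
    intro v hv w hw
    rw [key v hv, key w hw]
  · refine ⟨(Finset.range m).image C.rpair, ⟨?_, ?_, ?_, ?_⟩, ?_⟩
    · intro p hp
      obtain ⟨s, hs, rfl⟩ := Finset.mem_image.1 hp
      rw [Finset.mem_range] at hs
      constructor
      · rw [rpair, Finset.card_pair]
        intro e
        have := (C.hinj s hs 0 hT0 _ (hpre s hs) (T-1) (by omega) e).2
        omega
      · intro v hv
        rw [rpair, Finset.mem_insert, Finset.mem_singleton] at hv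
        rw [C.mem_splitEnds]
        rcases hv with rfl | rfl
        · exact ⟨s, hs, Or.inl rfl⟩
        · exact ⟨_, hpre s hs, Or.inr rfl⟩
    · intro p hp q hq hne
      obtain ⟨s, hs, rfl⟩ := Finset.mem_image.1 hp
      obtain ⟨s', hs', rfl⟩ := Finset.mem_image.1 hq
      rw [Finset.mem_range] at hs hs'
      rw [Finset.disjoint_left]
      intro v hv hv'
      exact hne (by rw [hpair_disj s hs s' hs' v hv hv'])
    · ext v
      rw [Finset.mem_biUnion, C.mem_splitEnds]
      constructor
      · rintro ⟨p, hp, hv⟩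
        obtain ⟨s, hs, rfl⟩ := Finset.mem_image.1 hp
        rw [Finset.mem_range] at hs
        simp only [id, rpair, Finset.mem_insert, Finset.mem_singleton] at hv
        rcases hv with rfl | rfl
        · exact ⟨s, hs, Or.inl rfl⟩
        · exact ⟨_, hpre s hs, Or.inr rfl⟩
      · rintro ⟨s, hs, rfl | rfl⟩
        · exact ⟨C.rpair s, Finset.mem_image.2 ⟨s, Finset.mem_range.2 hs, rfl⟩, by
            simp only [id, rpair]; exact Finset.mem_insert_self _ _⟩
        · refine ⟨C.rpair ((s + 2) % m), Finset.mem_image.2 ⟨_, Finset.mem_range.2 (Nat.mod_lt _ hm0), rfl⟩, ?_⟩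
          have : ((s + 2) % m + (m - 2)) % m = s := by
            rw [Nat.mod_add_mod, show s + 2 + (m - 2) = s + m by omega, Nat.add_mod_right,
              Nat.mod_eq_of_lt hs]
          simp only [id, rpair, this]
          rw [Finset.mem_insert, Finset.mem_singleton]; right; rfl
    · set R : ℕ → ℕ → Prop := (fun a b => ({a, b} : Finset ℕ) ∈ (Finset.range m).image C.rpair ∨
        ∃ i ∈ C.I, ({a, b} : Finset ℕ) = {H.pEndB i t, H.pEndA (nextIdx C.I i)}) with hRdef
      have hsymm : ∀ a b, R a b → R b a := by
        intro a b h
        simp only [hRdef] at h ⊢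
        rwa [Finset.pair_comm b a]
      have hsymm' : ∀ a b, Relation.ReflTransGen R a b → Relation.ReflTransGen R b a := by
        intro a b h
        induction h with
        | refl => exact Relation.ReflTransGen.refl
        | tail _ h2 ih => exact Relation.ReflTransGen.head (hsymm _ _ h2) ih
      have harc : ∀ s < m, R (C.P s (T-1)) (C.P ((s+1) % m) 0) := by
        intro s hs
        right
        refine ⟨C.J s, C.mem_I.2 ⟨s, hs, rfl⟩, ?_⟩
        have hn : nextIdx C.I (C.J s) = C.J ((s+1) % m) := C.hnext s hs
        rw [hn, C.hB s hs, C.hA _ (Nat.mod_lt _ hm0)]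
      have hpr : ∀ s < m, R (C.P s 0) (C.P ((s + (m - 2)) % m) (T - 1)) := by
        intro s hs
        left
        exact Finset.mem_image.2 ⟨s, Finset.mem_range.2 hs, rfl⟩
      have hstep : ∀ s, s + 1 < m → Relation.ReflTransGen R (C.P (s+1) 0) (C.P s 0) := by
        intro s hs
        have e1 := hpr (s+1) hs
        have e2 := harc _ (hpre (s+1) hs)
        have e : ((s + 1 + (m - 2)) % m + 1) % m = s := by
          rw [Nat.mod_add_mod, show s + 1 + (m - 2) + 1 = s + m by omega, Nat.add_mod_right,
              Nat.mod_eq_of_lt (by omega)]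
        rw [e] at e2
        exact (Relation.ReflTransGen.single e1).tail e2
      have hto0 : ∀ s, s < m → Relation.ReflTransGen R (C.P s 0) (C.P 0 0) := by
        intro s
        induction s with
        | zero => intro _; exact Relation.ReflTransGen.refl
        | succ s ih => intro hs; exact (hstep s hs).trans (ih (by omega))
      have hall : ∀ u ∈ splitEnds H t C.I, Relation.ReflTransGen R u (C.P 0 0) := by
        intro u hu
        obtain ⟨s, hs, rfl | rfl⟩ := C.mem_splitEnds.1 hu
        · exact hto0 s hs
        · exact Relation.ReflTransGen.head (harc s hs) (hto0 _ (Nat.mod_lt _ hm0))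
      intro u hu v hv
      exact (hall u hu).trans (hsymm' _ _ (hall v hv))
    · intro h hh
      rw [Finset.mem_range] at hh
      have : (((Finset.range m).image C.rpair).filter fun p => p ⊆ C.part rr h) =
          ((Finset.range m).filter fun s => s % T = h).image C.rpair := by
        ext p
        simp only [Finset.mem_filter, Finset.mem_image, Finset.mem_range]
        constructor
        · rintro ⟨⟨s, hs, rfl⟩, hsub⟩
          refine ⟨s, ⟨hs, ?_⟩, rfl⟩
          exact hdisj _ (Nat.mod_lt _ hT0) h hh (C.P s 0) (hA_mem s hs)
            (hsub (by rw [rpair]; exact Finset.mem_insert_self _ _))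
        · rintro ⟨s, ⟨hs, rfl⟩, rfl⟩
          exact ⟨⟨s, hs, rfl⟩, hpair_sub s hs⟩
      rw [this, Finset.card_image_of_injOn]
      · rw [hmdef]; exact card_mod_eq T (mtOf k t) h hh
      · intro s hs s' hs' e
        simp only [Finset.coe_filter, Finset.mem_range] at hs hs'
        exact hrinj s hs.1 s' hs'.1 e
  · intro h hh
    exact hdeg h (Finset.mem_range.1 hh)

end PathCfg

lemma nextIdx_eq_of_gt (I : Finset ℕ) (i i' : ℕ) (hi' : i' ∈ I) (h : i < i')
    (hmin : ∀ x ∈ I, i < x → i' ≤ x) : nextIdx I i = i' := by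
  unfold nextIdx
  have hm : i' ∈ I.filter fun x => i < x := Finset.mem_filter.2 ⟨hi', h⟩
  rw [dif_pos ⟨i', hm⟩]
  apply le_antisymm
  · exact Finset.min'_le _ _ hm
  · apply Finset.le_min'
    intro y hy
    rw [Finset.mem_filter] at hy
    exact hmin y hy.1 hy.2

lemma nextIdx_eq_of_wrap (I : Finset ℕ) (i i' : ℕ) (hi' : i' ∈ I) (hmax : ∀ x ∈ I, x ≤ i)
    (hmin : ∀ x ∈ I, i' ≤ x) : nextIdx I i = i' := by
  unfold nextIdx
  rw [dif_neg, dif_pos ⟨i', hi'⟩]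
  · apply le_antisymm
    · exact Finset.min'_le _ _ hi'
    · apply Finset.le_min'
      exact hmin
  · rintro ⟨x, hx⟩
    rw [Finset.mem_filter] at hx
    have := hmax x hx.1
    omega

lemma nextIdx_cyc (N i₀ m : ℕ) (hi : i₀ < N) (a : ℕ → ℕ) (ha0 : a 0 = 0)
    (hmono : ∀ s s', s < s' → s' < m → a s < a s') (hlt : ∀ s < m, a s < N) (s : ℕ) (hs : s < m) :
    nextIdx ((Finset.range m).image fun s => (i₀ + a s) % N) ((i₀ + a s) % N) =
      (i₀ + a ((s + 1) % m)) % N := by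
  have hmod : ∀ s < m, (i₀ + a s) % N = if i₀ + a s < N then i₀ + a s else i₀ + a s - N := by
    intro s hs
    have := hlt s hs
    split_ifs with h
    · exact Nat.mod_eq_of_lt h
    · rw [Nat.mod_eq_sub_mod (by omega), Nat.mod_eq_of_lt (by omega)]
  have hmem : ∀ x, x ∈ ((Finset.range m).image fun s => (i₀ + a s) % N) →
      ∃ y < m, x = (if i₀ + a y < N then i₀ + a y else i₀ + a y - N) := by
    intro x hx
    obtain ⟨y, hy, rfl⟩ := Finset.mem_image.1 hx
    exact ⟨y, Finset.mem_range.1 hy, hmod y (Finset.mem_range.1 hy)⟩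
  have hmm : (s + 1) % m < m := Nat.mod_lt _ (by omega)
  have hin : (i₀ + a ((s + 1) % m)) % N ∈ ((Finset.range m).image fun s => (i₀ + a s) % N) :=
    Finset.mem_image.2 ⟨_, Finset.mem_range.2 hmm, rfl⟩
  have hs0 := hlt s hs
  have hall : ∀ y < m, (y < s → a y < a s) ∧ (s < y → a s < a y) ∧ (y = s → a y = a s) ∧ a y < N :=
    fun y hy => ⟨fun h => hmono y s h hs, fun h => hmono s y h hy, fun h => by rw [h], hlt y hy⟩
  by_cases hlast : s + 1 < m
  · have e : (s + 1) % m = s + 1 := Nat.mod_eq_of_lt hlast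
    rw [e] at hin ⊢
    have hsucc : ∀ y < m, (s + 1 < y → a (s+1) < a y) ∧ (y = s + 1 → a y = a (s+1)) :=
      fun y hy => ⟨fun h => hmono _ _ h hy, fun h => by rw [h]⟩
    have h1 := hall (s+1) hlast
    by_cases hw : i₀ + a s < N ∧ N ≤ i₀ + a (s + 1)
    · apply nextIdx_eq_of_wrap _ _ _ hin
      · intro x hx
        obtain ⟨y, hy, rfl⟩ := hmem x hx
        have h2 := hall y hy
        have h3 := hsucc y hy
        rw [hmod s hs]
        split_ifs <;> omega
      · intro x hx
        obtain ⟨y, hy, rfl⟩ := hmem x hx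
        have h2 := hall y hy
        have h3 := hsucc y hy
        rw [hmod _ hlast]
        split_ifs <;> omega
    · apply nextIdx_eq_of_gt _ _ _ hin
      · rw [hmod s hs, hmod _ hlast]
        split_ifs <;> omega
      · intro x hx
        obtain ⟨y, hy, rfl⟩ := hmem x hx
        have h2 := hall y hy
        have h3 := hsucc y hy
        rw [hmod _ hlast, hmod s hs]
        split_ifs <;> omega
  · have e : (s + 1) % m = 0 := by
      have : s + 1 = m := by omega
      rw [this, Nat.mod_self]
    rw [e] at hin ⊢
    rw [ha0, Nat.add_zero, Nat.mod_eq_of_lt hi] at hin ⊢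
    have hz : ∀ y, y < m → y ≤ s := fun y hy => by omega
    by_cases hw : i₀ + a s < N
    · apply nextIdx_eq_of_wrap _ _ _ hin
      · intro x hx
        obtain ⟨y, hy, rfl⟩ := hmem x hx
        have h2 := hall y hy
        have := hz y hy
        rw [hmod s hs]
        split_ifs <;> omega
      · intro x hx
        obtain ⟨y, hy, rfl⟩ := hmem x hx
        have h2 := hall y hy
        have := hz y hy
        split_ifs <;> omega
    · apply nextIdx_eq_of_gt _ _ _ hin
      · rw [hmod s hs]
        split_ifs <;> omega
      · intro x hx
        obtain ⟨y, hy, rfl⟩ := hmem x hx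
        have h2 := hall y hy
        have := hz y hy
        rw [hmod s hs]
        split_ifs <;> omega

section
variable {k : ℕ} {G : HGraph k} (H : LooseHamCycle k G)

/-- Vertex at position `p` after the start of the `i₀`-th edge. -/
def posV (i₀ p : ℕ) : ℕ := H.σ ((i₀ * (k - 1) + p) % G.verts.card)

lemma posV_inj (i₀ p p' : ℕ) (hp : p < G.verts.card) (hp' : p' < G.verts.card)
    (h : posV H i₀ p = posV H i₀ p') : p = p' := by
  have hn : 0 < G.verts.card := by omega
  have h1 := H.injOn (Set.mem_Iio.2 (Nat.mod_lt _ hn)) (Set.mem_Iio.2 (Nat.mod_lt _ hn)) h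
  have : p ≡ p' [MOD G.verts.card] := Nat.ModEq.add_left_cancel' _ h1
  rwa [Nat.ModEq, Nat.mod_eq_of_lt hp, Nat.mod_eq_of_lt hp'] at this

lemma posV_mem (i₀ p : ℕ) (hn : 0 < G.verts.card) : posV H i₀ p ∈ G.verts := by
  rw [← H.image_eq]
  exact Finset.mem_image.2 ⟨_, Finset.mem_range.2 (Nat.mod_lt _ hn), rfl⟩

lemma posV_image (i₀ : ℕ) : (Finset.range G.verts.card).image (posV H i₀) = G.verts := by
  rcases Nat.eq_zero_or_pos G.verts.card with h | h
  · rw [h]; rw [Finset.card_eq_zero] at h; rw [h]; rfl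
  apply Finset.eq_of_subset_of_card_le
  · intro v hv
    obtain ⟨p, _, rfl⟩ := Finset.mem_image.1 hv
    exact posV_mem H i₀ p h
  · rw [Finset.card_image_of_injOn, Finset.card_range]
    intro p hp p' hp' e
    exact posV_inj H i₀ p p' (by simpa using hp) (by simpa using hp') e

lemma idx_pos (i₀ a r N : ℕ) (hN : G.verts.card = N * (k - 1)) :
    H.σ (((i₀ + a) % N * (k - 1) + r) % G.verts.card) = posV H i₀ (a * (k - 1) + r) := by
  unfold posV
  congr 1
  rw [hN, ← Nat.mul_mod_mul_right, Nat.mod_add_mod]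
  congr 1; ring

/-- The path configuration with offsets `a`. -/
def mkCfg (t m i₀ : ℕ) (hk : 2 ≤ k) (hN : G.verts.card = numE G * (k - 1)) (hi : i₀ < numE G)
    (a : ℕ → ℕ) (ha0 : a 0 = 0) (hmono : ∀ s s', s < s' → s' < m → a s + t < a s')
    (hlt : ∀ s < m, a s + t < numE G) : PathCfg H t m where
  J := fun s => (i₀ + a s) % numE G
  P := fun s r => posV H i₀ (a s * (k - 1) + r)
  hP := by
    intro s _
    unfold LooseHamCycle.pVerts
    simp only [idx_pos H i₀ (a s) _ _ hN]
    rfl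
  hA := by
    intro s _
    unfold LooseHamCycle.pEndA
    have := idx_pos H i₀ (a s) 0 _ hN
    simpa using this
  hB := by
    intro s _
    unfold LooseHamCycle.pEndB
    rw [idx_pos H i₀ (a s) _ _ hN]
    rfl
  hinj := by
    have hkey : ∀ s < m, ∀ r < TOf k t, a s * (k - 1) + r < G.verts.card := by
      intro s hs r hr
      unfold TOf at hr
      have h1 := hlt s hs
      have : (a s + t + 1) * (k - 1) ≤ G.verts.card := by
        rw [hN]; exact Nat.mul_le_mul_right _ h1
      have e : (a s + t + 1) * (k - 1) = a s * (k - 1) + t * (k - 1) + (k - 1) := by ring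
      omega
    have hsep : ∀ s s' r r', s < s' → s' < m → r < TOf k t →
        a s * (k - 1) + r < a s' * (k - 1) + r' := by
      intro s s' r r' hss hs' hr
      unfold TOf at hr
      have h1 := hmono s s' hss hs'
      have : (a s + t + 1) * (k - 1) ≤ a s' * (k - 1) := Nat.mul_le_mul_right _ h1
      have e : (a s + t + 1) * (k - 1) = a s * (k - 1) + t * (k - 1) + (k - 1) := by ring
      omega
    intro s hs r hr s' hs' r' hr' h
    have h1 := posV_inj H i₀ _ _ (hkey s hs r hr) (hkey s' hs' r' hr') h
    rcases lt_trichotomy s s' with h2 | h2 | h2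
    · have := hsep s s' r r' h2 hs' hr; omega
    · subst h2; exact ⟨rfl, by omega⟩
    · have := hsep s' s r' r h2 hs hr'; omega
  hN := fun s _ => Nat.mod_lt _ (by omega)
  hnext := by
    intro s hs
    exact nextIdx_cyc (numE G) i₀ m hi a ha0
      (fun s s' h h' => by have := hmono s s' h h'; omega) (fun s h => by have := hlt s h; omega) s hs

end

def ddF (T s h : ℕ) : ℕ := (h + (T - s % T)) % T

/-- position used by part `h` in path `s` with rotation `ρ` -/
def rrF (T s h ρ : ℕ) : ℕ :=
  if ddF T s h = 0 then 0 else if ddF T s h = 2 then T - 1 else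
    1 + ((if ddF T s h = 1 then 0 else ddF T s h - 2) + ρ) % (T - 2)

lemma ddF_lt {T : ℕ} (hT : 3 ≤ T) (s h : ℕ) : ddF T s h < T := Nat.mod_lt _ (by omega)

lemma rrF_lt {T : ℕ} (hT : 3 ≤ T) (s h ρ : ℕ) : rrF T s h ρ < T := by
  unfold rrF
  split_ifs
  · omega
  · omega
  all_goals
    refine lt_of_lt_of_le (Nat.add_lt_add_left (Nat.mod_lt _ (by omega)) 1) (by omega)

lemma mod_add_inj {T a b c : ℕ} (ha : a < T) (hb : b < T) (h : (a + c) % T = (b + c) % T) : a = b := by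
  have : a ≡ b [MOD T] := Nat.ModEq.add_right_cancel' c h
  rwa [Nat.ModEq, Nat.mod_eq_of_lt ha, Nat.mod_eq_of_lt hb] at this

lemma rrF_inj {T : ℕ} (hT : 3 ≤ T) (s ρ h h' : ℕ) (hh : h < T) (hh' : h' < T)
    (e : rrF T s h ρ = rrF T s h' ρ) : h = h' := by
  have hd := ddF_lt hT s h
  have hd' := ddF_lt hT s h'
  have key : ddF T s h = ddF T s h' := by
    unfold rrF at e
    generalize ddF T s h = d at *
    generalize ddF T s h' = d' at *
    have hm : ∀ z, z % (T - 2) < T - 2 := fun z => Nat.mod_lt _ (by omega)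
    have h1 := hm ((if d = 1 then 0 else d - 2) + ρ)
    have h2 := hm ((if d' = 1 then 0 else d' - 2) + ρ)
    by_cases c1 : d = 0
    · rw [if_pos c1] at e
      by_cases c2 : d' = 0
      · omega
      · rw [if_neg c2] at e
        split_ifs at e <;> omega
    · rw [if_neg c1] at e
      by_cases c2 : d' = 0
      · rw [if_pos c2] at e
        split_ifs at e <;> omega
      · rw [if_neg c2] at e
        by_cases c3 : d = 2
        · rw [if_pos c3] at e
          by_cases c4 : d' = 2
          · omega
          · rw [if_neg c4] at e; omega
        · rw [if_neg c3] at e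
          by_cases c4 : d' = 2
          · rw [if_pos c4] at e; omega
          · rw [if_neg c4] at e
            have e' := mod_add_inj (by split_ifs <;> omega) (by split_ifs <;> omega) (Nat.add_left_cancel e)
            split_ifs at e' <;> omega
  exact mod_add_inj hh hh' key

lemma rrF_zero {T : ℕ} (hT : 3 ≤ T) (s ρ : ℕ) : rrF T s (s % T) ρ = 0 := by
  have : ddF T s (s % T) = 0 := by
    unfold ddF
    have := Nat.mod_lt s (show 0 < T by omega)
    rw [show s % T + (T - s % T) = T by omega, Nat.mod_self]
  unfold rrF
  rw [if_pos this]

lemma rrF_two {T : ℕ} (hT : 3 ≤ T) (s ρ : ℕ) : rrF T s ((s + 2) % T) ρ = T - 1 := by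
  have : ddF T s ((s + 2) % T) = 2 := by
    unfold ddF
    have := Nat.mod_lt s (show 0 < T by omega)
    rw [← Nat.mod_add_mod s T 2, Nat.mod_add_mod, show s % T + 2 + (T - s % T) = 2 + T by omega,
      Nat.add_mod_right, Nat.mod_eq_of_lt (by omega)]
  unfold rrF
  rw [this]; simp

lemma rrF_surj {T : ℕ} (hT : 3 ≤ T) (s h r : ℕ) (h0 : ddF T s h ≠ 0) (h2 : ddF T s h ≠ 2)
    (hr1 : 1 ≤ r) (hr2 : r ≤ T - 2) : ∃ ρ < T - 2, rrF T s h ρ = r := by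
  unfold rrF
  simp only [if_neg h0, if_neg h2]
  have hd := ddF_lt hT s h
  set x := (if ddF T s h = 1 then 0 else ddF T s h - 2) with hx
  have hxl : x < T - 2 := by rw [hx]; split_ifs <;> omega
  refine ⟨(r - 1 + (T - 2 - x)) % (T - 2), Nat.mod_lt _ (by omega), ?_⟩
  rw [Nat.add_mod_mod, show x + (r - 1 + (T - 2 - x)) = r - 1 + (T - 2) by omega, Nat.add_mod_right,
    Nat.mod_eq_of_lt (by omega)]
  omega

/-- `d = 0` or `d = 2` only for few `s`. -/
lemma card_dd_bad {T : ℕ} (hT : 3 ≤ T) (q h : ℕ) (hh : h < T) :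
    ((Finset.range (T * q)).filter fun s => ddF T s h = 0 ∨ ddF T s h = 2).card ≤ 2 * q := by
  have hsub : ((Finset.range (T * q)).filter fun s => ddF T s h = 0 ∨ ddF T s h = 2) ⊆
      ((Finset.range (T * q)).filter fun s => s % T = h) ∪
      ((Finset.range (T * q)).filter fun s => s % T = (h + (T - 2)) % T) := by
    intro s hs
    rw [Finset.mem_filter] at hs
    have hsl := Nat.mod_lt s (show 0 < T by omega)
    rw [Finset.mem_union, Finset.mem_filter, Finset.mem_filter]
    rcases hs.2 with h1 | h1
    · left
      refine ⟨hs.1, ?_⟩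
      unfold ddF at h1
      symm
      apply mod_add_inj hh hsl (c := T - s % T)
      rw [h1, show s % T + (T - s % T) = T by omega, Nat.mod_self]
    · right
      refine ⟨hs.1, ?_⟩
      unfold ddF at h1
      symm
      apply mod_add_inj (Nat.mod_lt _ (by omega)) hsl (c := T - s % T)
      rw [Nat.mod_add_mod, show h + (T - 2) + (T - s % T) = (h + (T - s % T)) + (T - 2) by omega,
        ← Nat.mod_add_mod, h1, show s % T + (T - s % T) = T by omega, show 2 + (T - 2) = T by omega]
  calc _ ≤ _ := Finset.card_le_card hsub
    _ ≤ _ := Finset.card_union_le _ _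
    _ = q + q := by rw [card_mod_eq T q h hh, card_mod_eq T q _ (Nat.mod_lt _ (by omega))]
    _ = _ := by ring

lemma deg_lower {k : ℕ} (G : HGraph k) {ι : Type} (S : Finset ℕ) (j : ℕ) (hj : j < k)
    (hSc : S.card = j) (D : Finset ℕ) (blk : ℕ → ι) (Bz : ℕ)
    (hfib : ∀ b, (G.verts.filter fun v => blk v = b).card ≤ Bz) :
    G.degOn S ≤ (G.edges.filter fun e => S ⊆ e ∧ e \ S ⊆ D ∧ Set.InjOn blk ((e \ S : Finset ℕ) : Set ℕ)).card +
      G.verts.card ^ (k - j - 1) * ((G.verts \ D).card + (k - j) * Bz) := by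
  unfold HGraph.degOn
  set V := G.verts with hV
  set q := k - j with hq
  set A := (V.powersetCard (q-1)).biUnion fun F' =>
    ((V \ D) ∪ F'.biUnion fun v => V.filter fun w => blk w = blk v).image fun v => insert v F' with hA
  have hAc : A.card ≤ V.card ^ (q - 1) * ((V \ D).card + q * Bz) := by
    calc A.card ≤ (V.powersetCard (q-1)).card * ((V \ D).card + q * Bz) := by
          refine Finset.card_biUnion_le_card_mul _ _ _ fun F' hF' => ?_
          rw [Finset.mem_powersetCard] at hF'
          refine Finset.card_image_le.trans ((Finset.card_union_le _ _).trans ?_)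
          gcongr
          calc _ ≤ F'.card * Bz := Finset.card_biUnion_le_card_mul _ _ _ fun v _ => hfib _
            _ ≤ q * Bz := by rw [hF'.2]; exact Nat.mul_le_mul_right _ (by omega)
      _ ≤ _ := by
          gcongr
          rw [Finset.card_powersetCard]
          exact Nat.choose_le_pow _ _
  have hsplit : (G.edges.filter fun e => S ⊆ e) ⊆
      (G.edges.filter fun e => S ⊆ e ∧ e \ S ⊆ D ∧ Set.InjOn blk ((e \ S : Finset ℕ) : Set ℕ)) ∪
      A.image (fun F => S ∪ F) := by
    intro e he
    rw [Finset.mem_filter] at he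
    have hec := G.edge_card e he.1
    have hev := G.edge_sub e he.1
    have hFc : (e \ S).card = q := by rw [Finset.card_sdiff_of_subset he.2]; omega
    have hFV : e \ S ⊆ V := Finset.sdiff_subset.trans hev
    rw [Finset.mem_union, Finset.mem_filter]
    by_cases hg : e \ S ⊆ D ∧ Set.InjOn blk ((e \ S : Finset ℕ) : Set ℕ)
    · exact Or.inl ⟨he.1, he.2, hg⟩
    right
    refine Finset.mem_image.2 ⟨e \ S, ?_, Finset.union_sdiff_of_subset he.2⟩
    rw [hA, Finset.mem_biUnion]
    have hex : ∃ v ∈ e \ S, v ∈ (V \ D) ∪ ((e \ S).erase v).biUnion fun v => V.filter fun w => blk w = blk v := by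
      by_cases hD : e \ S ⊆ D
      · have hni : ¬ Set.InjOn blk ((e \ S : Finset ℕ) : Set ℕ) := fun h => hg ⟨hD, h⟩
        unfold Set.InjOn at hni
        push Not at hni
        obtain ⟨v, hv, w, hw, hvw, hne⟩ := hni
        refine ⟨v, hv, Finset.mem_union.2 (Or.inr ?_)⟩
        rw [Finset.mem_biUnion]
        exact ⟨w, Finset.mem_erase.2 ⟨hne.symm, hw⟩, Finset.mem_filter.2 ⟨hFV hv, hvw⟩⟩
      · rw [Finset.not_subset] at hD
        obtain ⟨v, hv, hvD⟩ := hD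
        exact ⟨v, hv, Finset.mem_union.2 (Or.inl (Finset.mem_sdiff.2 ⟨hFV hv, hvD⟩))⟩
    obtain ⟨v, hv, hvm⟩ := hex
    refine ⟨(e \ S).erase v, ?_, Finset.mem_image.2 ⟨v, hvm, Finset.insert_erase hv⟩⟩
    rw [Finset.mem_powersetCard]
    exact ⟨(Finset.erase_subset _ _).trans hFV, by rw [Finset.card_erase_of_mem hv, hFc]⟩
  calc _ ≤ _ := Finset.card_le_card hsplit
    _ ≤ _ := Finset.card_union_le _ _
    _ ≤ _ := by
      gcongr
      exact Finset.card_image_le.trans hAc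

def famD {k : ℕ} (G : HGraph k) {m : ℕ} (blk : ℕ → Fin m) (Dh : Finset ℕ) (J : Finset (Fin m))
    (S : Finset ℕ) : Finset (Finset ℕ) :=
  (G.edges.filter fun e => S ⊆ e ∧ e \ S ⊆ Dh.filter (fun v => blk v ∉ J) ∧
    Set.InjOn blk ((e \ S : Finset ℕ) : Set ℕ)).image (fun e => e \ S)

lemma famD_spec {k : ℕ} (G : HGraph k) {m : ℕ} (blk : ℕ → Fin m) (Dh : Finset ℕ) (J : Finset (Fin m))
    (S F : Finset ℕ) (hF : F ∈ famD G blk Dh J S) : S ∪ F ∈ G.edges ∧ Disjoint S F ∧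
      (∀ v ∈ F, v ∈ Dh ∧ blk v ∉ J) ∧ Set.InjOn blk (F : Set ℕ) ∧ F.card = k - S.card := by
  unfold famD at hF
  obtain ⟨e, he, rfl⟩ := Finset.mem_image.1 hF
  rw [Finset.mem_filter] at he
  obtain ⟨he1, he2, he3, he4⟩ := he
  refine ⟨?_, Finset.disjoint_sdiff, ?_, he4, ?_⟩
  · rwa [Finset.union_sdiff_of_subset he2]
  · intro v hv
    exact Finset.mem_filter.1 (he3 hv)
  · rw [Finset.card_sdiff_of_subset he2, G.edge_card e he1]

lemma famD_card {k : ℕ} (G : HGraph k) {m : ℕ} (blk : ℕ → Fin m) (Dh : Finset ℕ) (J : Finset (Fin m))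
    (S : Finset ℕ) : (famD G blk Dh J S).card = (G.edges.filter fun e => S ⊆ e ∧
      e \ S ⊆ Dh.filter (fun v => blk v ∉ J) ∧ Set.InjOn blk ((e \ S : Finset ℕ) : Set ℕ)).card := by
  unfold famD
  apply Finset.card_image_of_injOn
  intro e he f hf h
  simp only [Finset.coe_filter, Set.mem_ofPred_eq] at he hf
  have h' : e \ S = f \ S := h
  rw [← Finset.union_sdiff_of_subset he.2.1, ← Finset.union_sdiff_of_subset hf.2.1, h']

lemma minDeg_abs {Ω : Type} [Fintype Ω] [Nonempty Ω] {m k : ℕ} (hm : 0 < m) (G : HGraph k) (j : ℕ)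
    (hj : j < k) (x : Fin m → Ω → ℕ) (blk : ℕ → Fin m) (hblk : ∀ s ω, blk (x s ω) = s)
    (hx : ∀ s ω, x s ω ∈ G.verts) (Dh : Finset ℕ) (a : ℕ)
    (hD : ∀ v ∈ Dh, a ≤ (univ.filter fun ω => x (blk v) ω = v).card) (Bz : ℕ)
    (hfib : ∀ b, (G.verts.filter fun v => blk v = b).card ≤ Bz) (d : ℝ) (hdeg : G.MinDegGe j d)
    (η θ : ℝ) (hη : 0 < η)
    (hnum : θ + η * (m : ℝ) ^ (k - j) ≤ (d - (G.verts.card : ℝ) ^ (k - j - 1) *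
      ((G.verts \ Dh).card + k * Bz)) * ((a : ℝ) / Fintype.card Ω) ^ (k - j)) :
    ((univ.filter fun Y : Fin m → Ω =>
      ¬ G.MinDegOnGe j (univ.image fun s => x s (Y s)) θ).card : ℝ) ≤
      (m : ℝ) ^ j * ((Fintype.card Ω : ℝ) ^ m * Real.exp (-(η ^ 2 * m / 2))) := by
  set SS : Finset (Fin m) → (Fin m → Ω) → Finset ℕ := fun J y => J.image fun s => x s (y s) with hSS
  have hxi : ∀ y : Fin m → Ω, Function.Injective fun s => x s (y s) := by
    intro y s s' h
    have := congrArg blk h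
    simpa [hblk] using this
  have hSc : ∀ J y, (SS J y).card = J.card := fun J y => Finset.card_image_of_injective _ (hxi y)
  have hJ : ∀ J ∈ (univ : Finset (Fin m)).powersetCard j,
      ((univ.filter fun Y : Fin m → Ω => (gcount x blk (famD G blk Dh J (SS J Y)) Y : ℝ) < θ).card : ℝ)
        ≤ (Fintype.card Ω : ℝ) ^ m * Real.exp (-(η ^ 2 * m / 2)) := by
    intro J hJ
    have hJc : J.card = j := (Finset.mem_powersetCard.1 hJ).2
    apply swap_count J (fun y Y => (gcount x blk (famD G blk Dh J (SS J y)) Y : ℝ) < θ)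
    · intro y y' Y Y' h1 h2
      have e1 : SS J y = SS J y' := by
        simp only [hSS]
        apply Finset.image_congr
        intro s hs
        simp only [h1 s (by simpa using hs)]
      have e2 : gcount x blk (famD G blk Dh J (SS J y')) Y = gcount x blk (famD G blk Dh J (SS J y')) Y' := by
        unfold gcount
        congr 1
        apply Finset.filter_congr
        intro F hF
        have hs := famD_spec G blk Dh J _ F hF
        apply forall₂_congr
        intro v hv
        rw [h2 _ (hs.2.2.1 v hv).2]
      simp only [e1, e2]
    · intro y
      apply gcount_tail hm x blk _ (k - j) a (by omega)
      · intro F hF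
        have hs := famD_spec G blk Dh J _ F hF
        rw [hs.2.2.2.2, hSc, hJc]
      · intro F hF
        exact (famD_spec G blk Dh J _ F hF).2.2.2.1
      · intro F hF v hv
        exact hD v ((famD_spec G blk Dh J _ F hF).2.2.1 v hv).1
      · exact hη
      · refine hnum.trans ?_
        apply mul_le_mul_of_nonneg_right _ (by positivity)
        have h1 : G.degOn (SS J y) ≤ (famD G blk Dh J (SS J y)).card + G.verts.card ^ (k - j - 1) *
            ((G.verts \ (Dh.filter fun v => blk v ∉ J)).card + (k - j) * Bz) := by
          rw [famD_card]
          convert deg_lower G (SS J y) j hj (by rw [hSc, hJc]) (Dh.filter fun v => blk v ∉ J) blk Bz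
            (by intro b; convert hfib b)
        have h2 := hdeg (SS J y) (by
          intro v hv
          obtain ⟨s, _, rfl⟩ := Finset.mem_image.1 hv
          exact hx _ _) (by rw [hSc, hJc])
        have h3 : (G.verts \ (Dh.filter fun v => blk v ∉ J)).card ≤ (G.verts \ Dh).card + j * Bz := by
          have hsub : G.verts \ (Dh.filter fun v => blk v ∉ J) ⊆
              (G.verts \ Dh) ∪ J.biUnion fun b => G.verts.filter fun v => blk v = b := by
            intro v hv
            simp only [Finset.mem_sdiff, Finset.mem_filter, Finset.mem_union, Finset.mem_biUnion] at hv ⊢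
            by_cases h : v ∈ Dh
            · right
              refine ⟨blk v, ?_, hv.1, rfl⟩
              by_contra hc
              exact hv.2 ⟨h, hc⟩
            · left; exact ⟨hv.1, h⟩
          refine (Finset.card_le_card hsub).trans ((Finset.card_union_le _ _).trans ?_)
          apply Nat.add_le_add_left
          rw [← hJc]
          exact Finset.card_biUnion_le_card_mul _ _ _ (fun b _ => hfib b)
        have h4 : (G.verts \ (Dh.filter fun v => blk v ∉ J)).card + (k - j) * Bz ≤
            (G.verts \ Dh).card + k * Bz := by
          have : k * Bz = j * Bz + (k - j) * Bz := by rw [← Nat.add_mul]; congr 1; omega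
          omega
        have h5 := h1.trans (Nat.add_le_add_left (Nat.mul_le_mul_left _ h4) _)
        have h6 : (G.degOn (SS J y) : ℝ) ≤ ((famD G blk Dh J (SS J y)).card : ℝ) +
          (G.verts.card : ℝ) ^ (k - j - 1) * ((G.verts \ Dh).card + k * Bz) := by exact_mod_cast h5
        linarith
  have hsub : (univ.filter fun Y : Fin m → Ω =>
      ¬ G.MinDegOnGe j (univ.image fun s => x s (Y s)) θ) ⊆
      ((univ : Finset (Fin m)).powersetCard j).biUnion fun J =>
        univ.filter fun Y : Fin m → Ω => (gcount x blk (famD G blk Dh J (SS J Y)) Y : ℝ) < θ := by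
    intro Y hY
    rw [Finset.mem_filter] at hY
    by_contra hc
    apply hY.2
    intro T hT hTc
    set J := univ.filter fun s => x s (Y s) ∈ T with hJd
    have hST : SS J Y = T := by
      ext v
      simp only [hSS, Finset.mem_image, hJd, Finset.mem_filter, Finset.mem_univ, true_and]
      constructor
      · rintro ⟨s, hs, rfl⟩; exact hs
      · intro hv
        obtain ⟨s, _, rfl⟩ := Finset.mem_image.1 (hT hv)
        exact ⟨s, hv, rfl⟩
    have hJc : J.card = j := by rw [← hSc J Y, hST, hTc]
    have h1 : θ ≤ (gcount x blk (famD G blk Dh J T) Y : ℝ) := by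
      by_contra h
      apply hc
      rw [Finset.mem_biUnion]
      refine ⟨J, Finset.mem_powersetCard.2 ⟨Finset.subset_univ _, hJc⟩, ?_⟩
      rw [Finset.mem_filter, hST]
      exact ⟨Finset.mem_univ _, not_le.1 h⟩
    refine h1.trans ?_
    norm_cast
    unfold gcount
    apply Finset.card_le_card_of_injOn (fun F => T ∪ F)
    · intro F hF
      simp only [Finset.coe_filter, Set.mem_ofPred_eq] at hF
      have hs := famD_spec G blk Dh J _ F hF.1
      simp only [HGraph.inducedEdges, Finset.coe_filter, Set.mem_ofPred_eq, Finset.mem_filter]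
      refine ⟨⟨hs.1, Finset.union_subset hT ?_⟩, Finset.subset_union_left⟩
      intro v hv
      exact Finset.mem_image.2 ⟨_, Finset.mem_univ _, hF.2 v hv⟩
    · intro F hF F' hF' h
      simp only [Finset.coe_filter, Set.mem_ofPred_eq] at hF hF'
      have hs := (famD_spec G blk Dh J _ F hF.1).2.1
      have hs' := (famD_spec G blk Dh J _ F' hF'.1).2.1
      have h' : T ∪ F = T ∪ F' := h
      rw [← Finset.union_sdiff_cancel_left hs, h', Finset.union_sdiff_cancel_left hs']
  have hcard : ((univ : Finset (Fin m)).powersetCard j).card ≤ m ^ j := by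
    rw [Finset.card_powersetCard, Finset.card_univ, Fintype.card_fin]
    exact Nat.choose_le_pow m j
  calc _ ≤ (((((univ : Finset (Fin m)).powersetCard j).biUnion fun J =>
        univ.filter fun Y : Fin m → Ω => (gcount x blk (famD G blk Dh J (SS J Y)) Y : ℝ) < θ).card : ℕ) : ℝ) := by
        exact_mod_cast Finset.card_le_card hsub
    _ ≤ ((∑ J ∈ (univ : Finset (Fin m)).powersetCard j,
        (univ.filter fun Y : Fin m → Ω => (gcount x blk (famD G blk Dh J (SS J Y)) Y : ℝ) < θ).card : ℕ) : ℝ) := by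
        exact_mod_cast Finset.card_biUnion_le
    _ ≤ ∑ J ∈ (univ : Finset (Fin m)).powersetCard j,
        ((Fintype.card Ω : ℝ) ^ m * Real.exp (-(η ^ 2 * m / 2))) := by
        push_cast
        exact Finset.sum_le_sum hJ
    _ = (((univ : Finset (Fin m)).powersetCard j).card : ℝ) * ((Fintype.card Ω : ℝ) ^ m * Real.exp (-(η ^ 2 * m / 2))) := by
        rw [Finset.sum_const, nsmul_eq_mul]
    _ ≤ _ := by
        apply mul_le_mul_of_nonneg_right _ (by positivity)
        exact_mod_cast hcard

section
variable {k : ℕ} {G : HGraph k} (H : LooseHamCycle k G)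

def pinv (i₀ v : ℕ) : ℕ :=
  if h : ∃ p < G.verts.card, posV H i₀ p = v then h.choose else 0

lemma pinv_posV (i₀ p : ℕ) (hp : p < G.verts.card) : pinv H i₀ (posV H i₀ p) = p := by
  have h : ∃ p' < G.verts.card, posV H i₀ p' = posV H i₀ p := ⟨p, hp, rfl⟩
  unfold pinv
  rw [dif_pos h]
  exact posV_inj H i₀ _ _ h.choose_spec.1 hp h.choose_spec.2

lemma pinv_spec (i₀ v : ℕ) (hv : v ∈ G.verts) :
    pinv H i₀ v < G.verts.card ∧ posV H i₀ (pinv H i₀ v) = v := by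
  rw [← posV_image H i₀] at hv
  obtain ⟨p, hp, rfl⟩ := Finset.mem_image.1 hv
  rw [Finset.mem_range] at hp
  rw [pinv_posV H i₀ p hp]
  exact ⟨hp, rfl⟩

lemma pinv_injOn (i₀ : ℕ) : Set.InjOn (pinv H i₀) (G.verts : Set ℕ) := by
  intro v hv w hw h
  rw [← (pinv_spec H i₀ v hv).2, h, (pinv_spec H i₀ w hw).2]

/-- offset of path `s` -/
def offF (L s u : ℕ) : ℕ := if s = 0 then 0 else s * L + u

/-- the vertex in part `h` of path `s` -/
def xxF (i₀ t L : ℕ) (h s u ρ : ℕ) : ℕ :=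
  posV H i₀ (offF L s u * (k - 1) + rrF (TOf k t) s h ρ)

lemma off_bd {L b t s u : ℕ} (hb : b + t = L) (hu : u < b) :
    s * L ≤ offF L s u ∧ offF L s u + t + 1 ≤ (s + 1) * L := by
  unfold offF
  have e : (s + 1) * L = s * L + L := by ring
  split_ifs with h
  · subst h; simp; omega
  · omega

lemma pos_bd {L b t s u r : ℕ} (hb : b + t = L) (hu : u < b) (hr : r < TOf k t) (hk : 2 ≤ k) :
    s * (L * (k - 1)) ≤ offF L s u * (k - 1) + r ∧
    offF L s u * (k - 1) + r < (s + 1) * (L * (k - 1)) := by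
  obtain ⟨h1, h2⟩ := off_bd (s := s) hb hu
  have h3 := Nat.mul_le_mul_right (k - 1) h1
  have h4 := Nat.mul_le_mul_right (k - 1) h2
  unfold TOf at hr
  constructor
  · rw [← mul_assoc]; omega
  · rw [← mul_assoc]
    have e : (offF L s u + t + 1) * (k - 1) = offF L s u * (k - 1) + t * (k - 1) + (k - 1) := by ring
    omega

lemma pos_lt {L b t s u r m N : ℕ} (hb : b + t = L) (hu : u < b) (hr : r < TOf k t) (hk : 2 ≤ k)
    (hs : s < m) (hmL : m * L ≤ N) (hN : G.verts.card = N * (k - 1)) :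
    offF L s u * (k - 1) + r < G.verts.card := by
  have h1 := (pos_bd (s := s) hb hu hr hk).2
  have h2 : (s + 1) * (L * (k - 1)) ≤ N * (k - 1) := by
    rw [← mul_assoc]
    exact Nat.mul_le_mul_right _ ((Nat.mul_le_mul_right _ hs).trans hmL)
  omega

/-- block of a vertex -/
def blkF (i₀ L m : ℕ) (hm : 0 < m) (v : ℕ) : Fin m :=
  ⟨min (pinv H i₀ v / (L * (k - 1))) (m - 1), by omega⟩

lemma blk_posV {i₀ L m N p : ℕ} (hm : 0 < m) (s : Fin m) (hmL : m * L ≤ N)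
    (hN : G.verts.card = N * (k - 1))
    (h1 : s * (L * (k - 1)) ≤ p) (h2 : p < (s + 1) * (L * (k - 1))) :
    blkF H i₀ L m hm (posV H i₀ p) = s := by
  have hp : p < G.verts.card := by
    have h3 : ((s : ℕ) + 1) * (L * (k - 1)) ≤ N * (k - 1) := by
      rw [← mul_assoc]
      exact Nat.mul_le_mul_right _ ((Nat.mul_le_mul_right _ s.2).trans hmL)
    omega
  apply Fin.ext
  unfold blkF
  simp only
  rw [pinv_posV H i₀ p hp, Nat.div_eq_of_lt_le h1 h2]
  have := s.2
  omega

lemma blk_fib {i₀ L m N : ℕ} (hm : 0 < m) (hL : 0 < L) (hk : 2 ≤ k) (hmL2 : N ≤ m * L + m)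
    (hN : G.verts.card = N * (k - 1)) (c : Fin m) :
    (G.verts.filter fun v => blkF H i₀ L m hm v = c).card ≤ (L + m) * (k - 1) := by
  have hB : 0 < L * (k - 1) := Nat.mul_pos hL (by omega)
  have h : (G.verts.filter fun v => blkF H i₀ L m hm v = c).card ≤
      (Finset.Ico (c * (L * (k-1))) (c * (L * (k-1)) + (L + m) * (k - 1))).card := by
    apply Finset.card_le_card_of_injOn (pinv H i₀)
    · intro v hv
      rw [Finset.mem_coe, Finset.mem_filter] at hv
      have h1 := (pinv_spec H i₀ v hv.1).1
      have h2 := congrArg Fin.val hv.2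
      unfold blkF at h2
      simp only at h2
      rw [Finset.mem_coe, Finset.mem_Ico]
      set p := pinv H i₀ v
      have h3 := Nat.div_add_mod p (L * (k-1))
      have h4 := Nat.mod_lt p hB
      have e : (L + m) * (k - 1) = L * (k-1) + m * (k-1) := by ring
      have hc := c.2
      rcases le_or_gt (p / (L * (k-1))) (m-1) with h5 | h5
      · rw [min_eq_left h5] at h2
        rw [h2] at h3
        rw [mul_comm] at h3
        constructor <;> omega
      · rw [min_eq_right h5.le] at h2
        have h6 : (m - 1) * (L * (k-1)) ≤ p := by
          refine le_trans (Nat.mul_le_mul_right _ h5.le) ?_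
          exact Nat.div_mul_le_self _ _
        rw [← h2]
        refine ⟨h6, ?_⟩
        have h7 : N * (k-1) ≤ (m * L + m) * (k-1) := Nat.mul_le_mul_right _ hmL2
        have h8 : (m * L + m) * (k-1) = (m-1) * (L * (k-1)) + (L + m) * (k - 1) := by
          obtain ⟨m', rfl⟩ : ∃ m', m = m' + 1 := ⟨m - 1, by omega⟩
          simp only [Nat.add_sub_cancel]; ring
        omega
    · exact (pinv_injOn H i₀).mono (by intro v hv; exact (Finset.mem_filter.1 hv).1)
  rw [Nat.card_Ico] at h
  omega

/-- The good vertices. -/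
def DhF (i₀ t m L b h : ℕ) : Finset ℕ :=
  G.verts.filter fun v => ∃ s w c, s < m ∧ s ≠ 0 ∧ ddF (TOf k t) s h ≠ 0 ∧ ddF (TOf k t) s h ≠ 2 ∧
    t ≤ w ∧ w < b ∧ c < k - 1 ∧ pinv H i₀ v = (s * L + w) * (k - 1) + c

lemma Dh_compl {i₀ t L b h N q m : ℕ} (hT : 3 ≤ TOf k t) (hh : h < TOf k t)
    (hmdef : m = TOf k t * q) (hb : b + t = L)
    (hk : 2 ≤ k) (hmL2 : N ≤ m * L + m) (hL : 0 < L)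
    (hN : G.verts.card = N * (k - 1)) :
    (G.verts \ DhF H i₀ t m L b h).card ≤ ((1 + 2 * q) * L + 2 * t * m + m) * (k - 1) := by
  set B1 := ((Finset.range m).filter fun s => s = 0 ∨ (ddF (TOf k t) s h = 0 ∨ ddF (TOf k t) s h = 2)) with hB1
  have hB1c : B1.card ≤ 1 + 2 * q := by
    rw [hB1, Finset.filter_or]
    refine (Finset.card_union_le _ _).trans ?_
    apply Nat.add_le_add
    · refine (Finset.card_le_card (t := {0}) ?_).trans (by simp)
      intro s hs; rw [Finset.mem_filter] at hs; simp [hs.2]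
    · rw [hmdef]; exact card_dd_bad hT q h hh
  set E := ((B1 ×ˢ Finset.range L).image fun x => x.1 * L + x.2) ∪
    ((Finset.range m ×ˢ (Finset.range t ∪ Finset.Ico b L)).image fun x => x.1 * L + x.2) ∪
    Finset.Ico (m * L) (m * L + m) with hE
  have hEc : E.card ≤ (1 + 2 * q) * L + 2 * t * m + m := by
    rw [hE]
    refine (Finset.card_union_le _ _).trans ?_
    apply Nat.add_le_add
    · refine (Finset.card_union_le _ _).trans ?_
      apply Nat.add_le_add
      · refine Finset.card_image_le.trans ?_
        rw [Finset.card_product, Finset.card_range]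
        exact Nat.mul_le_mul_right _ hB1c
      · refine Finset.card_image_le.trans ?_
        rw [Finset.card_product, Finset.card_range, mul_comm]
        apply Nat.mul_le_mul_right
        refine (Finset.card_union_le _ _).trans ?_
        rw [Finset.card_range, Nat.card_Ico]; omega
    · rw [Nat.card_Ico]; omega
  have hmap : (G.verts \ DhF H i₀ t m L b h).card ≤ (E ×ˢ Finset.range (k-1)).card := by
    apply Finset.card_le_card_of_injOn (fun v => (pinv H i₀ v / (k-1), pinv H i₀ v % (k-1)))
    · intro v hv
      rw [Finset.mem_coe, Finset.mem_sdiff] at hv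
      have h1 := (pinv_spec H i₀ v hv.1).1
      rw [Finset.mem_coe, Finset.mem_product, Finset.mem_range]
      refine ⟨?_, Nat.mod_lt _ (by omega)⟩
      set p := pinv H i₀ v with hp
      set e := p / (k-1) with he
      have heN : e < N := by
        rw [he, Nat.div_lt_iff_lt_mul (by omega)]; omega
      simp only [hE, Finset.mem_union, Finset.mem_image, Finset.mem_product, Finset.mem_range,
        Finset.mem_Ico, Prod.exists]
      have hd := Nat.div_add_mod e L
      have hml := Nat.mod_lt e hL
      rw [mul_comm] at hd
      by_cases c1 : m * L ≤ e
      · right; exact ⟨c1, heN.trans_le hmL2⟩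
      · left
        have hsm : e / L < m := by
          rw [Nat.div_lt_iff_lt_mul hL]; exact not_le.1 c1
        by_cases c2 : e / L ∈ B1
        · left
          exact ⟨_, _, ⟨c2, hml⟩, hd⟩
        · right
          refine ⟨e / L, e % L, ⟨hsm, ?_⟩, hd⟩
          by_contra c3
          push Not at c3
          apply hv.2
          unfold DhF
          rw [Finset.mem_filter]
          refine ⟨hv.1, e / L, e % L, p % (k-1), hsm, ?_, ?_, ?_, by omega, ?_, Nat.mod_lt _ (by omega), ?_⟩
          · intro h0; apply c2; rw [hB1, Finset.mem_filter, Finset.mem_range]; exact ⟨hsm, Or.inl h0⟩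
          · intro h0; apply c2; rw [hB1, Finset.mem_filter, Finset.mem_range]; exact ⟨hsm, Or.inr (Or.inl h0)⟩
          · intro h0; apply c2; rw [hB1, Finset.mem_filter, Finset.mem_range]; exact ⟨hsm, Or.inr (Or.inr h0)⟩
          · by_contra hc
            have := c3.2 (by omega)
            omega
          · rw [hd, ← hp, he, mul_comm, Nat.div_add_mod]
    · intro v hv w hw h
      rw [Finset.mem_coe, Finset.mem_sdiff] at hv hw
      apply pinv_injOn H i₀ hv.1 hw.1
      simp only [Prod.mk.injEq] at h
      rw [← Nat.div_add_mod (pinv H i₀ v) (k-1), h.1, h.2, Nat.div_add_mod]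
  rw [Finset.card_product, Finset.card_range] at hmap
  exact hmap.trans (Nat.mul_le_mul_right _ hEc)

lemma Dh_many {i₀ t L b h N m : ℕ} (hT : 3 ≤ TOf k t) (hm : 0 < m)
    (hb : b + t = L) (hk : 2 ≤ k) (hmL : m * L ≤ N)
    (hN : G.verts.card = N * (k - 1)) (v : ℕ) (hv : v ∈ DhF H i₀ t m L b h) :
    t - 1 ≤ ((univ : Finset (Fin b × Fin (TOf k t - 2))).filter fun ω =>
      xxF H i₀ t L h (blkF H i₀ L m hm v) ω.1 ω.2 = v).card := by
  unfold DhF at hv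
  rw [Finset.mem_filter] at hv
  obtain ⟨hvG, s, w, c, hs, hs0, hd0, hd2, htw, hwb, hc, hp⟩ := hv
  have hv2 := (pinv_spec H i₀ v hvG).2
  rw [hp] at hv2
  have hblk : blkF H i₀ L m hm v = ⟨s, hs⟩ := by
    rw [← hv2]
    have e1 : (s + 1) * (L * (k - 1)) = (s * L + L) * (k-1) := by ring
    have e2 : (s * L + w + 1) * (k-1) ≤ (s * L + L) * (k-1) := Nat.mul_le_mul_right _ (by omega)
    have e3 : (s * L + w + 1) * (k-1) = (s * L + w) * (k-1) + (k-1) := by ring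
    have e4 : s * (L * (k-1)) ≤ (s * L + w) * (k-1) := by
      rw [← mul_assoc]; exact Nat.mul_le_mul_right _ (by omega)
    apply blk_posV H hm ⟨s, hs⟩ hmL hN
    · simp only; omega
    · simp only; omega
  rw [hblk]
  have hsub : Finset.range (t - 1) ⊆ (((univ : Finset (Fin b × Fin (TOf k t - 2))).filter fun ω =>
      xxF H i₀ t L h s ω.1 ω.2 = v).image fun ω => w - 1 - (ω.1 : ℕ)) := by
    intro z hz
    rw [Finset.mem_range] at hz
    have hle : (z + 1 + 1) * (k - 1) ≤ t * (k - 1) := Nat.mul_le_mul_right _ (by omega)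
    have e1 : (z + 1 + 1) * (k - 1) = (z + 1) * (k-1) + (k-1) := by ring
    have hpos : 1 * 1 ≤ (z+1) * (k-1) := Nat.mul_le_mul (by omega) (by omega)
    obtain ⟨ρ, hρ, hr⟩ := rrF_surj hT s h ((z + 1) * (k - 1) + c) hd0 hd2 (by omega)
      (by unfold TOf; omega)
    rw [Finset.mem_image]
    refine ⟨(⟨w - 1 - z, by omega⟩, ⟨ρ, hρ⟩), ?_, by simp only; omega⟩
    rw [Finset.mem_filter]
    refine ⟨Finset.mem_univ _, ?_⟩
    unfold xxF offF
    simp only [if_neg hs0, hr]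
    rw [← hv2]
    congr 1
    have : w = w - 1 - z + (z + 1) := by omega
    conv_rhs => rw [this]
    ring
  have := (Finset.card_le_card hsub).trans Finset.card_image_le
  rwa [Finset.card_range] at this

/-- configuration associated to `Y` -/
def offY (L : ℕ) {m b c : ℕ} (Y : Fin m → Fin b × Fin c) (s : ℕ) : ℕ :=
  if h : s < m then offF L s (Y ⟨s, h⟩).1 else 0

def cfgY (i₀ t m L b : ℕ) (hb : b + t = L) (hk : 2 ≤ k) (hmL : m * L ≤ numE G)
    (hN : G.verts.card = numE G * (k - 1)) (hi : i₀ < numE G)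
    (Y : Fin m → Fin b × Fin (TOf k t - 2)) : PathCfg H t m :=
  mkCfg H t m i₀ hk hN hi (offY L Y)
    (by unfold offY offF; split_ifs <;> simp_all)
    (by
      intro s s' hss hs'
      unfold offY
      rw [dif_pos hs', dif_pos (hss.trans hs')]
      have h1 := off_bd (s := s) hb (Y ⟨s, hss.trans hs'⟩).1.2
      have h2 := off_bd (s := s') hb (Y ⟨s', hs'⟩).1.2
      have h3 : (s + 1) * L ≤ s' * L := Nat.mul_le_mul_right _ hss
      omega)
    (by
      intro s hs
      unfold offY
      rw [dif_pos hs]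
      have h1 := off_bd (s := s) hb (Y ⟨s, hs⟩).1.2
      have h3 : (s + 1) * L ≤ m * L := Nat.mul_le_mul_right _ hs
      omega)

def rrY (t : ℕ) {m b c : ℕ} (k : ℕ) (Y : Fin m → Fin b × Fin c) (s h : ℕ) : ℕ :=
  if hs : s < m then rrF (TOf k t) s h (Y ⟨s, hs⟩).2 else 0

lemma part_eq (i₀ t m L b : ℕ) (hb : b + t = L) (hk : 2 ≤ k) (hmL : m * L ≤ numE G)
    (hN : G.verts.card = numE G * (k - 1)) (hi : i₀ < numE G)
    (Y : Fin m → Fin b × Fin (TOf k t - 2)) (h : ℕ) :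
    (cfgY H i₀ t m L b hb hk hmL hN hi Y).part (rrY t k Y) h =
      univ.image fun s : Fin m => xxF H i₀ t L h s (Y s).1 (Y s).2 := by
  unfold PathCfg.part
  ext v
  simp only [Finset.mem_image, Finset.mem_range, Finset.mem_univ, true_and]
  constructor
  · rintro ⟨s, hs, rfl⟩
    refine ⟨⟨s, hs⟩, ?_⟩
    simp [cfgY, mkCfg, offY, rrY, hs, xxF]
  · rintro ⟨s, rfl⟩
    refine ⟨s, s.2, ?_⟩
    simp [cfgY, mkCfg, offY, rrY, xxF]

lemma cfgY_J0 (i₀ t m L b : ℕ) (hb : b + t = L) (hk : 2 ≤ k) (hmL : m * L ≤ numE G)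
    (hN : G.verts.card = numE G * (k - 1)) (hi : i₀ < numE G)
    (Y : Fin m → Fin b × Fin (TOf k t - 2)) :
    (cfgY H i₀ t m L b hb hk hmL hN hi Y).J 0 = i₀ := by
  have : offY L Y 0 = 0 := by unfold offY offF; split_ifs <;> simp_all
  simp [cfgY, mkCfg, this, Nat.mod_eq_of_lt hi]

end

section
variable {k : ℕ} {G : HGraph k} (H : LooseHamCycle k G)

lemma minDeg_bad {i₀ t L b m q : ℕ} (j : ℕ) (hj : j < k) (hT : 3 ≤ TOf k t) (hm : 0 < m)
    (hmdef : m = TOf k t * q) (hb : b + t = L) (hb0 : 0 < b) (ht : 1 ≤ t)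
    (hk : 2 ≤ k) (hmL : m * L ≤ numE G) (hmL2 : numE G ≤ m * L + m)
    (hN : G.verts.card = numE G * (k - 1)) (hi : i₀ < numE G) (d : ℝ) (hdeg : G.MinDegGe j d)
    (η θ : ℝ) (hη : 0 < η)
    (hnum : θ + η * (m : ℝ) ^ (k - j) ≤ (d - (G.verts.card : ℝ) ^ (k - j - 1) *
      ((((1 + 2 * q) * L + 2 * t * m + m) * (k - 1) : ℕ) + k * (((L + m) * (k - 1) : ℕ) : ℝ))) *
        (((t - 1 : ℕ) : ℝ) / (b * (TOf k t - 2 : ℕ) : ℕ)) ^ (k - j)) :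
    ((univ.filter fun Y : Fin m → Fin b × Fin (TOf k t - 2) => ∃ h < TOf k t,
      ¬ G.MinDegOnGe j ((cfgY H i₀ t m L b hb hk hmL hN hi Y).part (rrY t k Y) h) θ).card : ℝ) ≤
      TOf k t * ((m : ℝ) ^ j * (((b * (TOf k t - 2) : ℕ) : ℝ) ^ m * Real.exp (-(η ^ 2 * m / 2)))) := by
  have : Nonempty (Fin b × Fin (TOf k t - 2)) := ⟨(⟨0, hb0⟩, ⟨0, by omega⟩)⟩
  have hcard : Fintype.card (Fin b × Fin (TOf k t - 2)) = b * (TOf k t - 2) := by simp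
  have hn : 0 < G.verts.card := by rw [hN]; exact Nat.mul_pos (by omega) (by omega)
  have hone : ∀ h ∈ Finset.range (TOf k t),
      ((univ.filter fun Y : Fin m → Fin b × Fin (TOf k t - 2) => ¬ G.MinDegOnGe j
        (univ.image fun s : Fin m => xxF H i₀ t L h s (Y s).1 (Y s).2) θ).card : ℝ) ≤
      (m : ℝ) ^ j * (((b * (TOf k t - 2) : ℕ) : ℝ) ^ m * Real.exp (-(η ^ 2 * m / 2))) := by
    intro h hh
    rw [Finset.mem_range] at hh
    have := minDeg_abs (Ω := Fin b × Fin (TOf k t - 2)) hm G j hj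
      (fun s ω => xxF H i₀ t L h s ω.1 ω.2) (blkF H i₀ L m hm)
      (by
        intro s ω
        have h1 := pos_bd (k := k) (s := s) (r := rrF (TOf k t) s h ω.2) hb ω.1.2 (rrF_lt hT _ _ _) hk
        exact blk_posV H hm s hmL hN h1.1 h1.2)
      (by intro s ω; exact posV_mem H i₀ _ hn)
      (DhF H i₀ t m L b h) (t - 1)
      (by
        intro v hv
        convert Dh_many H hT hm hb hk hmL hN v hv)
      ((L + m) * (k - 1))
      (by
        intro c
        convert blk_fib H hm (by omega) hk hmL2 hN c)
      d hdeg η θ hη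
      (by
        rw [hcard]
        refine hnum.trans ?_
        apply mul_le_mul_of_nonneg_right _ (by positivity)
        have h2 := Dh_compl H (i₀ := i₀) (h := h) hT hh hmdef hb hk hmL2 (by omega) hN
        have h3 : ((G.verts \ DhF H i₀ t m L b h).card : ℝ) ≤ (((1 + 2 * q) * L + 2 * t * m + m) * (k - 1) : ℕ) := by
          exact_mod_cast h2
        have : (0 : ℝ) ≤ (G.verts.card : ℝ) ^ (k - j - 1) := by positivity
        gcongr)
    rw [hcard] at this
    convert this
  calc _ ≤ ((((Finset.range (TOf k t)).biUnion fun h => univ.filter fun Y : Fin m → Fin b × Fin (TOf k t - 2) => ¬ G.MinDegOnGe j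
        (univ.image fun s : Fin m => xxF H i₀ t L h s (Y s).1 (Y s).2) θ).card : ℕ) : ℝ) := by
        norm_cast
        apply Finset.card_le_card
        intro Y hY
        rw [Finset.mem_filter] at hY
        obtain ⟨h, hh, hY⟩ := hY.2
        rw [part_eq] at hY
        exact Finset.mem_biUnion.2 ⟨h, Finset.mem_range.2 hh, Finset.mem_filter.2 ⟨Finset.mem_univ _, hY⟩⟩
    _ ≤ ((∑ h ∈ Finset.range (TOf k t), (univ.filter fun Y : Fin m → Fin b × Fin (TOf k t - 2) => ¬ G.MinDegOnGe j
        (univ.image fun s : Fin m => xxF H i₀ t L h s (Y s).1 (Y s).2) θ).card : ℕ) : ℝ) := by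
        norm_cast
        exact Finset.card_biUnion_le
    _ ≤ _ := by
        push_cast
        refine (Finset.sum_le_sum hone).trans ?_
        rw [Finset.sum_const, nsmul_eq_mul, Finset.card_range]
        push_cast
        exact le_rfl

lemma hit_bad {i₀ t L b m : ℕ} (hT : 3 ≤ TOf k t)
    (hb : b + t = L) (hb0 : 0 < b)
    (hk : 2 ≤ k) (hmL : m * L ≤ numE G)
    (hN : G.verts.card = numE G * (k - 1)) (hi : i₀ < numE G) (q w : ℕ) (W : Finset ℕ)
    (hW : W.card ≤ w) :
    ((univ.filter fun Y : Fin m → Fin b × Fin (TOf k t - 2) =>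
      q ≤ ((cfgY H i₀ t m L b hb hk hmL hN hi Y).hit W).card).card : ℝ) ≤
      2 ^ m * (((w * TOf k t * (TOf k t - 2) : ℕ) : ℝ) / (b * (TOf k t - 2) : ℕ)) ^ q *
        ((b * (TOf k t - 2) : ℕ) : ℝ) ^ m := by
  have : Nonempty (Fin b × Fin (TOf k t - 2)) := ⟨(⟨0, hb0⟩, ⟨0, by omega⟩)⟩
  have hcard : Fintype.card (Fin b × Fin (TOf k t - 2)) = b * (TOf k t - 2) := by simp
  set D : Fin m → Finset (Fin b × Fin (TOf k t - 2)) := fun s =>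
    univ.filter fun ω => ∃ r < TOf k t, posV H i₀ (offF L s ω.1 * (k - 1) + r) ∈ W with hD
  have h := aux_hits m q (w * TOf k t * (TOf k t - 2)) (univ.filter fun s : Fin m => (s : ℕ) ≠ 0) D (by
    intro s hs
    rw [Finset.mem_filter] at hs
    have hsub : D s ⊆ (W ×ˢ Finset.range (TOf k t)).biUnion fun x =>
        univ.filter fun ω => posV H i₀ (offF L s ω.1 * (k - 1) + x.2) = x.1 := by
      intro ω hω
      rw [hD, Finset.mem_filter] at hω
      obtain ⟨r, hr, hrW⟩ := hω.2
      rw [Finset.mem_biUnion]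
      exact ⟨(_, r), Finset.mem_product.2 ⟨hrW, Finset.mem_range.2 hr⟩,
        Finset.mem_filter.2 ⟨Finset.mem_univ _, rfl⟩⟩
    refine (Finset.card_le_card hsub).trans ?_
    refine (Finset.card_biUnion_le_card_mul _ _ (TOf k t - 2) ?_).trans ?_
    · rintro ⟨v, r⟩ hx
      rw [Finset.mem_product, Finset.mem_range] at hx
      have : (univ : Finset (Fin (TOf k t - 2))).card = TOf k t - 2 := by simp
      refine le_trans (Finset.card_le_card_of_injOn (t := (univ : Finset (Fin (TOf k t - 2)))) (fun ω => ω.2)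
        (fun _ _ => Finset.mem_coe.2 (Finset.mem_univ _)) ?_) this.le
      intro ω hω ω' hω' e
      rw [Finset.mem_coe, Finset.mem_filter] at hω hω'
      have h1 := pos_lt (G := G) (s := s) (r := r) hb ω.1.2 hx.2 hk s.2 hmL hN
      have h2 := pos_lt (G := G) (s := s) (r := r) hb ω'.1.2 hx.2 hk s.2 hmL hN
      have h3 := posV_inj H i₀ _ _ h1 h2 (hω.2.trans hω'.2.symm)
      have h4 : offF L s ω.1 = offF L s ω'.1 := Nat.eq_of_mul_eq_mul_right (show 0 < k - 1 by omega) (by omega)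
      unfold offF at h4
      rw [if_neg hs.2, if_neg hs.2] at h4
      exact Prod.ext (Fin.ext (by omega)) e
    · rw [Finset.card_product, Finset.card_range]
      exact Nat.mul_le_mul_right _ (Nat.mul_le_mul_right _ hW))
  rw [hcard] at h
  refine le_trans ?_ h
  norm_cast
  apply Finset.card_le_card
  intro Y hY
  rw [Finset.mem_filter] at hY ⊢
  refine ⟨Finset.mem_univ _, hY.2.trans ?_⟩
  have hsub : (cfgY H i₀ t m L b hb hk hmL hN hi Y).hit W ⊆
      ((univ.filter fun s : Fin m => (s : ℕ) ≠ 0).filter fun s => Y s ∈ D s).image Fin.val := by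
    intro s hs
    unfold PathCfg.hit at hs
    rw [Finset.mem_filter, Finset.mem_range] at hs
    obtain ⟨hs1, hs2, v, hv⟩ := hs
    rw [Finset.mem_inter, PathCfg.mem_pV _ hs1] at hv
    obtain ⟨⟨r, hr, rfl⟩, hvW⟩ := hv
    rw [Finset.mem_image]
    refine ⟨⟨s, hs1⟩, ?_, rfl⟩
    rw [Finset.mem_filter, Finset.mem_filter]
    refine ⟨⟨Finset.mem_univ _, hs2⟩, ?_⟩
    rw [hD, Finset.mem_filter]
    refine ⟨Finset.mem_univ _, r, hr, ?_⟩
    simpa [cfgY, mkCfg, offY, hs1] using hvW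
  refine (Finset.card_le_card hsub).trans (Finset.card_image_le.trans (le_of_eq ?_))
  congr

lemma edges_card_le (G : HGraph k) : G.edges.card ≤ G.verts.card ^ k := by
  have : G.edges ⊆ G.verts.powersetCard k := by
    intro e he
    exact Finset.mem_powersetCard.2 ⟨G.edge_sub e he, G.edge_card e he⟩
  refine (Finset.card_le_card this).trans ?_
  rw [Finset.card_powersetCard]
  exact Nat.choose_le_pow _ _

lemma bad1 {i₀ t L b m : ℕ} (hT : 3 ≤ TOf k t)
    (hb : b + t = L) (hb0 : 0 < b)
    (hk : 2 ≤ k) (hmL : m * L ≤ numE G)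
    (hN : G.verts.card = numE G * (k - 1)) (hi : i₀ < numE G) (χ : Finset ℕ → ℕ) (B : ℝ)
    (hχ : GloballyBounded G χ B) :
    ((univ.filter fun Y : Fin m → Fin b × Fin (TOf k t - 2) => ∃ e ∈ G.edges, (∃ f ∈ H.cedges, χ f = χ e) ∧
      k ≤ ((cfgY H i₀ t m L b hb hk hmL hN hi Y).hit e).card).card : ℝ) ≤
      (G.verts.card * B) * (2 ^ m * (((2 * k * TOf k t * (TOf k t - 2) : ℕ) : ℝ) / (b * (TOf k t - 2) : ℕ)) ^ k *
        ((b * (TOf k t - 2) : ℕ) : ℝ) ^ m) := by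
  set E := H.cedges.biUnion fun f => G.edges.filter fun e => χ e = χ f with hE
  have hB0 : 0 ≤ B := le_trans (by positivity) (hχ 0)
  have hEc : (E.card : ℝ) ≤ G.verts.card * B := by
    calc (E.card : ℝ) ≤ ((∑ f ∈ H.cedges, (G.edges.filter fun e => χ e = χ f).card : ℕ) : ℝ) := by
          exact_mod_cast Finset.card_biUnion_le
      _ ≤ ∑ f ∈ H.cedges, B := by push_cast; exact Finset.sum_le_sum fun f _ => hχ _
      _ = H.cedges.card * B := by rw [Finset.sum_const, nsmul_eq_mul]
      _ ≤ _ := by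
        apply mul_le_mul_of_nonneg_right _ hB0
        have h1 : H.cedges.card ≤ numE G := by
          unfold LooseHamCycle.cedges
          exact Finset.card_image_le.trans (by simp)
        have h2 : numE G ≤ G.verts.card := Nat.div_le_self _ _
        exact_mod_cast h1.trans h2
  calc _ ≤ (((E.biUnion fun e => univ.filter fun Y : Fin m → Fin b × Fin (TOf k t - 2) =>
        k ≤ ((cfgY H i₀ t m L b hb hk hmL hN hi Y).hit e).card).card : ℕ) : ℝ) := by
        norm_cast
        apply Finset.card_le_card
        intro Y hY
        rw [Finset.mem_filter] at hY
        obtain ⟨_, e, he, ⟨f, hf, hfe⟩, hq⟩ := hY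
        refine Finset.mem_biUnion.2 ⟨e, ?_, Finset.mem_filter.2 ⟨Finset.mem_univ _, hq⟩⟩
        exact Finset.mem_biUnion.2 ⟨f, hf, Finset.mem_filter.2 ⟨he, hfe.symm⟩⟩
    _ ≤ ((∑ e ∈ E, (univ.filter fun Y : Fin m → Fin b × Fin (TOf k t - 2) =>
        k ≤ ((cfgY H i₀ t m L b hb hk hmL hN hi Y).hit e).card).card : ℕ) : ℝ) := by
        exact_mod_cast Finset.card_biUnion_le
    _ ≤ ∑ e ∈ E, (2 ^ m * (((2 * k * TOf k t * (TOf k t - 2) : ℕ) : ℝ) / (b * (TOf k t - 2) : ℕ)) ^ k *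
        ((b * (TOf k t - 2) : ℕ) : ℝ) ^ m) := by
        push_cast
        apply Finset.sum_le_sum
        intro e he
        have := hit_bad H (i₀ := i₀) (m := m) hT hb hb0 hk hmL hN hi k (2 * k) e (by
          obtain ⟨f, _, hf⟩ := Finset.mem_biUnion.1 he
          rw [G.edge_card e (Finset.mem_filter.1 hf).1]; omega)
        push_cast at this
        exact this
    _ ≤ _ := by
        rw [Finset.sum_const, nsmul_eq_mul]
        exact mul_le_mul_of_nonneg_right hEc (by positivity)

lemma bad2 {i₀ t L b m : ℕ} (hT : 3 ≤ TOf k t)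
    (hb : b + t = L) (hb0 : 0 < b)
    (hk : 2 ≤ k) (hmL : m * L ≤ numE G)
    (hN : G.verts.card = numE G * (k - 1)) (hi : i₀ < numE G) (χ : Finset ℕ → ℕ) (B : ℝ)
    (hχ : GloballyBounded G χ B) :
    ((univ.filter fun Y : Fin m → Fin b × Fin (TOf k t - 2) => ∃ e ∈ G.edges, ∃ f ∈ G.edges, χ e = χ f ∧
      2 * k - 1 ≤ ((cfgY H i₀ t m L b hb hk hmL hN hi Y).hit (e ∪ f)).card).card : ℝ) ≤
      ((G.verts.card : ℝ) ^ k * B) * (2 ^ m * (((2 * k * TOf k t * (TOf k t - 2) : ℕ) : ℝ) / (b * (TOf k t - 2) : ℕ)) ^ (2 * k - 1) *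
        ((b * (TOf k t - 2) : ℕ) : ℝ) ^ m) := by
  set E := G.edges.sigma fun e => G.edges.filter fun f => χ f = χ e with hE
  have hB0 : 0 ≤ B := le_trans (by positivity) (hχ 0)
  have hEc : (E.card : ℝ) ≤ (G.verts.card : ℝ) ^ k * B := by
    rw [hE, Finset.card_sigma]
    push_cast
    calc _ ≤ ∑ f ∈ G.edges, B := Finset.sum_le_sum fun f _ => hχ _
      _ = G.edges.card * B := by rw [Finset.sum_const, nsmul_eq_mul]
      _ ≤ _ := by
        apply mul_le_mul_of_nonneg_right _ hB0
        exact_mod_cast edges_card_le G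
  calc _ ≤ (((E.biUnion fun p => univ.filter fun Y : Fin m → Fin b × Fin (TOf k t - 2) =>
        2 * k - 1 ≤ ((cfgY H i₀ t m L b hb hk hmL hN hi Y).hit (p.1 ∪ p.2)).card).card : ℕ) : ℝ) := by
        norm_cast
        apply Finset.card_le_card
        intro Y hY
        rw [Finset.mem_filter] at hY
        obtain ⟨_, e, he, f, hf, hfe, hq⟩ := hY
        refine Finset.mem_biUnion.2 ⟨⟨e, f⟩, ?_, Finset.mem_filter.2 ⟨Finset.mem_univ _, hq⟩⟩
        exact Finset.mem_sigma.2 ⟨he, Finset.mem_filter.2 ⟨hf, hfe.symm⟩⟩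
    _ ≤ ((∑ p ∈ E, (univ.filter fun Y : Fin m → Fin b × Fin (TOf k t - 2) =>
        2 * k - 1 ≤ ((cfgY H i₀ t m L b hb hk hmL hN hi Y).hit (p.1 ∪ p.2)).card).card : ℕ) : ℝ) := by
        exact_mod_cast Finset.card_biUnion_le
    _ ≤ ∑ p ∈ E, (2 ^ m * (((2 * k * TOf k t * (TOf k t - 2) : ℕ) : ℝ) / (b * (TOf k t - 2) : ℕ)) ^ (2 * k - 1) *
        ((b * (TOf k t - 2) : ℕ) : ℝ) ^ m) := by
        push_cast
        apply Finset.sum_le_sum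
        intro p hp
        have := hit_bad H (i₀ := i₀) (m := m) hT hb hb0 hk hmL hN hi (2 * k - 1) (2 * k) (p.1 ∪ p.2) (by
          obtain ⟨h1, h2⟩ := Finset.mem_sigma.1 hp
          refine (Finset.card_union_le _ _).trans ?_
          rw [G.edge_card _ h1, G.edge_card _ (Finset.mem_filter.1 h2).1]; omega)
        push_cast at this
        exact this
    _ ≤ _ := by
        rw [Finset.sum_const, nsmul_eq_mul]
        exact mul_le_mul_of_nonneg_right hEc (by positivity)

lemma I_fiber {i₀ t L b m : ℕ} (hm : 0 < m)
    (hb : b + t = L)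
    (hk : 2 ≤ k) (hmL : m * L ≤ numE G)
    (hN : G.verts.card = numE G * (k - 1)) (hi : i₀ < numE G)
    (A : Finset (Fin m → Fin b × Fin (TOf k t - 2))) :
    A.card ≤ b * (TOf k t - 2) ^ m *
      (A.image fun Y => (cfgY H i₀ t m L b hb hk hmL hN hi Y).I).card := by
  apply Finset.card_le_mul_card_image
  intro I hI
  obtain ⟨Y₀, hY₀, rfl⟩ := Finset.mem_image.1 hI
  have hu : ∀ Y, (cfgY H i₀ t m L b hb hk hmL hN hi Y).I = (cfgY H i₀ t m L b hb hk hmL hN hi Y₀).I →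
      ∀ s : Fin m, (s : ℕ) ≠ 0 → (Y s).1 = (Y₀ s).1 := by
    intro Y hYI s hs
    have h1 : (cfgY H i₀ t m L b hb hk hmL hN hi Y).J s ∈ (cfgY H i₀ t m L b hb hk hmL hN hi Y).I :=
      (PathCfg.mem_I _).2 ⟨s, s.2, rfl⟩
    rw [hYI, PathCfg.mem_I] at h1
    obtain ⟨s', hs', h2⟩ := h1
    have h3 : (i₀ + offF L s' (Y₀ ⟨s', hs'⟩).1) % numE G = (i₀ + offF L s (Y s).1) % numE G := by
      simpa [cfgY, mkCfg, offY, hs'] using h2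
    have b1 := off_bd (s := s') hb (Y₀ ⟨s', hs'⟩).1.2
    have b2 := off_bd (s := s) hb (Y s).1.2
    have c1 : (s' + 1) * L ≤ m * L := Nat.mul_le_mul_right _ hs'
    have c2 : ((s : ℕ) + 1) * L ≤ m * L := Nat.mul_le_mul_right _ s.2
    have h4 : offF L s' (Y₀ ⟨s', hs'⟩).1 = offF L s (Y s).1 := by
      have h5 : offF L s' (Y₀ ⟨s', hs'⟩).1 ≡ offF L s (Y s).1 [MOD numE G] := Nat.ModEq.add_left_cancel' _ h3
      rwa [Nat.ModEq, Nat.mod_eq_of_lt (by omega), Nat.mod_eq_of_lt (by omega)] at h5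
    have h6 : s' = s := by
      rcases lt_trichotomy s' (s : ℕ) with h | h | h
      · have := Nat.mul_le_mul_right L (show s' + 1 ≤ s by omega); omega
      · exact h
      · have := Nat.mul_le_mul_right L (show (s : ℕ) + 1 ≤ s' by omega); omega
    subst h6
    unfold offF at h4
    rw [if_neg hs, if_neg hs] at h4
    exact Fin.ext (by simpa using (Nat.add_left_cancel h4).symm)
  have hc : b * (TOf k t - 2) ^ m = (univ : Finset (Fin b × (Fin m → Fin (TOf k t - 2)))).card := by simp
  rw [hc]
  apply Finset.card_le_card_of_injOn (fun Y => ((Y ⟨0, hm⟩).1, fun s => (Y s).2))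
    (fun _ _ => Finset.mem_coe.2 (Finset.mem_univ _))
  intro Y hY Y' hY' h
  rw [Finset.mem_coe, Finset.mem_filter] at hY hY'
  simp only [Prod.mk.injEq] at h
  funext s
  apply Prod.ext
  · by_cases hs : (s : ℕ) = 0
    · have : s = ⟨0, hm⟩ := Fin.ext hs
      rw [this]; exact h.1
    · rw [hu Y hY.2 s hs, hu Y' hY'.2 s hs]
  · exact congrFun h.2 s

end

section
variable {k : ℕ} {G : HGraph k} (H : LooseHamCycle k G)

lemma final_fixed {i₀ t L b m : ℕ} (j : ℕ) (hj : j < k) (hT : 3 ≤ TOf k t) (hm : 0 < m)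
    (hmdef : m = mOf k t) (hb : b + t = L) (hb0 : 0 < b) (ht : 1 ≤ t)
    (hk : 2 ≤ k) (hmL : m * L ≤ numE G) (hmL2 : numE G ≤ m * L + m)
    (hN : G.verts.card = numE G * (k - 1)) (hi : i₀ < numE G) (d : ℝ) (hdeg : G.MinDegGe j d)
    (ε η : ℝ) (hη : 0 < η)
    (hnum : (looseHamThreshold j k + ε/2)*(m:ℝ)^(k-j) + η * (m : ℝ) ^ (k - j) ≤ (d - (G.verts.card : ℝ) ^ (k - j - 1) *
      ((((1 + 2 * mtOf k t) * L + 2 * t * m + m) * (k - 1) : ℕ) + k * (((L + m) * (k - 1) : ℕ) : ℝ))) *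
        (((t - 1 : ℕ) : ℝ) / (b * (TOf k t - 2 : ℕ) : ℕ)) ^ (k - j))
    (χ : Finset ℕ → ℕ) (B : ℝ) (hχ : GloballyBounded G χ B)
    (hε : (k * TOf k t : ℝ) ≤ ε*m/4)
    (p0 : (TOf k t : ℝ) * ((m : ℝ) ^ j * Real.exp (-(η ^ 2 * m / 2))) ≤ 1 / 4)
    (p1 : (G.verts.card * B) * (2 ^ m * (((2 * k * TOf k t * (TOf k t - 2) : ℕ) : ℝ) / (b * (TOf k t - 2) : ℕ)) ^ k) ≤ 1 / 8)
    (p2 : ((G.verts.card : ℝ) ^ k * B) * (2 ^ m * (((2 * k * TOf k t * (TOf k t - 2) : ℕ) : ℝ) / (b * (TOf k t - 2) : ℕ)) ^ (2 * k - 1)) ≤ 1 / 8) :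
    (b : ℝ) ^ (m - 1) / 2 ≤ (({I : Finset ℕ | IsSplitting H t I ∧ I.card = mOf k t ∧ i₀ ∈ I ∧
                    Suitable χ ε (mOf k t) H t I i₀ ∧
                    ∃ X : ℕ → Finset ℕ, IsViablePartition j ε t H I X}).ncard : ℝ) := by
  set C := cfgY H i₀ t m L b hb hk hmL hN hi with hC
  set θ := (looseHamThreshold j k + ε/2)*(m:ℝ)^(k-j) with hθ
  set B0 := univ.filter fun Y : Fin m → Fin b × Fin (TOf k t - 2) => ∃ h < TOf k t,
      ¬ G.MinDegOnGe j ((C Y).part (rrY t k Y) h) θ with hB0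
  set B1 := univ.filter fun Y : Fin m → Fin b × Fin (TOf k t - 2) => ∃ e ∈ G.edges, (∃ f ∈ H.cedges, χ f = χ e) ∧
      k ≤ ((C Y).hit e).card with hB1
  set B2 := univ.filter fun Y : Fin m → Fin b × Fin (TOf k t - 2) => ∃ e ∈ G.edges, ∃ f ∈ G.edges, χ e = χ f ∧
      2 * k - 1 ≤ ((C Y).hit (e ∪ f)).card with hB2
  set w : ℝ := ((b * (TOf k t - 2) : ℕ) : ℝ) ^ m with hw
  have hw0 : 0 ≤ w := by positivity
  have h0 : (B0.card : ℝ) ≤ 1/4 * w := by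
    refine (minDeg_bad H j hj hT hm (hmdef.trans rfl) hb hb0 ht hk hmL hmL2 hN hi d hdeg η θ hη hnum).trans ?_
    calc _ = (TOf k t : ℝ) * ((m : ℝ) ^ j * Real.exp (-(η ^ 2 * m / 2))) * w := by rw [hw]; ring
      _ ≤ _ := mul_le_mul_of_nonneg_right p0 hw0
  have h1 : (B1.card : ℝ) ≤ 1/8 * w := by
    refine (bad1 H hT hb hb0 hk hmL hN hi χ B hχ).trans ?_
    rw [← mul_assoc]
    exact mul_le_mul_of_nonneg_right p1 hw0
  have h2 : (B2.card : ℝ) ≤ 1/8 * w := by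
    refine (bad2 H hT hb hb0 hk hmL hN hi χ B hχ).trans ?_
    rw [← mul_assoc]
    exact mul_le_mul_of_nonneg_right p2 hw0
  set A := ((univ : Finset (Fin m → Fin b × Fin (TOf k t - 2))) \ (B0 ∪ B1 ∪ B2)) with hA
  have hAc : w / 2 ≤ (A.card : ℝ) := by
    have e1 : (univ : Finset (Fin m → Fin b × Fin (TOf k t - 2))).card = (b * (TOf k t - 2)) ^ m := by simp
    have e2 : (univ : Finset (Fin m → Fin b × Fin (TOf k t - 2))).card ≤ A.card + (B0.card + B1.card + B2.card) := by
      have : (univ : Finset (Fin m → Fin b × Fin (TOf k t - 2))).card ≤ A.card + (B0 ∪ B1 ∪ B2).card := by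
        rw [hA]
        convert Finset.card_le_card_sdiff_add_card
      have h3 := Finset.card_union_le (B0 ∪ B1) B2
      have h4 := Finset.card_union_le B0 B1
      omega
    have e3 : w ≤ (A.card : ℝ) + (B0.card + B1.card + B2.card) := by
      rw [hw]
      have : (b * (TOf k t - 2)) ^ m ≤ A.card + (B0.card + B1.card + B2.card) := by rw [← e1]; exact e2
      exact_mod_cast this
    linarith
  have hfib := I_fiber H (i₀ := i₀) hm hb hk hmL hN hi A
  have hfib' : (A.card : ℝ) ≤ (b : ℝ) * ((TOf k t - 2 : ℕ) : ℝ) ^ m * ((A.image fun Y => (C Y).I).card : ℝ) := by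
    exact_mod_cast hfib
  have hres : (b : ℝ) ^ (m - 1) / 2 ≤ ((A.image fun Y => (C Y).I).card : ℝ) := by
    have hbp : (0 : ℝ) < b := by exact_mod_cast hb0
    have hTp : (0 : ℝ) < ((TOf k t - 2 : ℕ) : ℝ) := by
      have : 0 < TOf k t - 2 := by omega
      exact_mod_cast this
    have e1 : w = (b : ℝ) * ((TOf k t - 2 : ℕ) : ℝ) ^ m * (b : ℝ) ^ (m - 1) := by
      rw [hw]; push_cast
      rw [mul_pow]
      obtain ⟨m', rfl⟩ : ∃ m', m = m' + 1 := ⟨m - 1, by omega⟩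
      simp only [Nat.add_sub_cancel]; ring
    have e2 := hAc.trans hfib'
    rw [e1, mul_div_assoc] at e2
    exact le_of_mul_le_mul_left e2 (by positivity)
  refine hres.trans ?_
  norm_cast
  rw [← Set.ncard_coe_finset]
  apply Set.ncard_le_ncard
  · intro I hI
    rw [Finset.mem_coe, Finset.mem_image] at hI
    obtain ⟨Y, hY, rfl⟩ := hI
    rw [hA, Finset.mem_sdiff, Finset.mem_union, Finset.mem_union, not_or, not_or] at hY
    obtain ⟨_, ⟨n0, n1⟩, n2⟩ := hY
    have hJ0 : (C Y).J 0 = i₀ := cfgY_J0 H i₀ t m L b hb hk hmL hN hi Y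
    refine ⟨(C Y).isSplitting, by rw [(C Y).card_I, hmdef], ?_, ?_, ⟨(C Y).part (rrY t k Y), ?_⟩⟩
    · exact (C Y).mem_I.2 ⟨0, hm, hJ0⟩
    · have := (C Y).suitable hm hk χ ε hε
        (by
          intro e he hc
          by_contra h
          exact n1 (Finset.mem_filter.2 ⟨Finset.mem_univ _, e, he, hc, not_lt.1 h⟩))
        (by
          intro e he f hf hc
          by_contra h
          exact n2 (Finset.mem_filter.2 ⟨Finset.mem_univ _, e, he, f, hf, hc, not_lt.1 h⟩))
      rw [hJ0] at this
      rwa [← hmdef]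
    · apply (C Y).viable hmdef hT (by omega) (rrY t k Y)
      · intro s hs h hh
        unfold rrY; rw [dif_pos hs]; exact rrF_lt hT _ _ _
      · intro s hs h hh h' hh' e
        unfold rrY at e; rw [dif_pos hs, dif_pos hs] at e; exact rrF_inj hT _ _ _ _ hh hh' e
      · intro s hs
        unfold rrY; rw [dif_pos hs]; exact rrF_zero hT _ _
      · intro s hs
        unfold rrY; rw [dif_pos hs]; exact rrF_two hT _ _
      · intro h hh
        rw [← hmdef]
        by_contra hc
        exact n0 (Finset.mem_filter.2 ⟨Finset.mem_univ _, h, hh, hc⟩)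
  · apply Set.Finite.subset (Finset.finite_toSet ((Finset.range (numE G)).powerset))
    intro I hI
    rw [Finset.mem_coe, Finset.mem_powerset]
    intro i hii
    exact Finset.mem_range.2 (hI.1.1 i hii)

lemma thr_nonneg (j k : ℕ) : 0 ≤ looseHamThreshold j k := by
  unfold looseHamThreshold
  apply Real.sInf_nonneg
  intro x hx
  exact hx.1

lemma deg_le_pow (G : HGraph k) (j : ℕ) (S : Finset ℕ) (hS : S.card = j) :
    G.degOn S ≤ G.verts.card ^ (k - j) := by
  unfold HGraph.degOn
  have : (G.edges.filter fun e => S ⊆ e).card ≤ (G.verts.powersetCard (k - j)).card := by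
    apply Finset.card_le_card_of_injOn (fun e => e \ S)
    · intro e he
      rw [Finset.mem_coe, Finset.mem_filter] at he
      rw [Finset.mem_coe, Finset.mem_powersetCard]
      refine ⟨Finset.sdiff_subset.trans (G.edge_sub e he.1), ?_⟩
      rw [Finset.card_sdiff_of_subset he.2, G.edge_card e he.1, hS]
    · intro e he f hf h
      rw [Finset.mem_coe, Finset.mem_filter] at he hf
      have h' : e \ S = f \ S := h
      rw [← Finset.union_sdiff_of_subset he.2, ← Finset.union_sdiff_of_subset hf.2, h']
  refine this.trans ?_
  rw [Finset.card_powersetCard]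
  exact Nat.choose_le_pow _ _

lemma thr_le_one (G : HGraph k) (j : ℕ) (x : ℝ) (n : ℕ) (hn : G.verts.card = n) (hn0 : 0 < n) (hjn : j ≤ n)
    (h : G.MinDegGe j (x * (n : ℝ) ^ (k - j))) : x ≤ 1 := by
  obtain ⟨S, hS, hSc⟩ := Finset.exists_subset_card_eq (hn.symm ▸ hjn : j ≤ G.verts.card)
  have h1 := h S hS hSc
  have h2 : (G.degOn S : ℝ) ≤ (n : ℝ) ^ (k - j) := by
    rw [← hn]; exact_mod_cast deg_le_pow G j S hSc
  have h3 : (0 : ℝ) < (n : ℝ) ^ (k - j) := by positivity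
  by_contra hc
  push Not at hc
  nlinarith

/-- main numeric inequality -/
lemma num_main (Q : ℕ) (hQ : 1 ≤ Q) (d ε n m err t b K : ℝ) (hd : 0 ≤ d) (hε : 0 < ε) (hd1 : d + ε ≤ 1)
    (hn : 0 < n) (hm : 0 < m)
    (herr : err ≤ ε / 8 * n) (ht : 2 ≤ t) (hb : 0 < b) (hK : 1 ≤ K) (hQt : Q / t ≤ ε / 8)
    (hnb : m * b * K ≤ n) :
    (d + ε/2) * m ^ Q + ε/4 * m ^ Q ≤
      ((d + ε) * n ^ Q - n ^ (Q - 1) * err) * ((t - 1) / (b * (t * K - 1))) ^ Q := by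
  have hD : 0 < b * (t * K - 1) := mul_pos hb (by nlinarith)
  have h1 : (d + 7*ε/8) * n ^ Q ≤ (d + ε) * n ^ Q - n ^ (Q - 1) * err := by
    have : n ^ (Q - 1) * err ≤ n ^ (Q - 1) * (ε / 8 * n) := mul_le_mul_of_nonneg_left herr (by positivity)
    have e : n ^ (Q - 1) * (ε / 8 * n) = ε / 8 * n ^ Q := by
      obtain ⟨q, rfl⟩ : ∃ q, Q = q + 1 := ⟨Q - 1, by omega⟩
      simp only [Nat.add_sub_cancel]; ring
    linarith
  have h2 : m * (1 - 1/t) ≤ n * ((t - 1) / (b * (t * K - 1))) := by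
    have e : m * (1 - 1/t) = m * (t - 1) / t := by field_simp
    rw [e, ← mul_div_assoc, div_le_div_iff₀ (by linarith) hD]
    have h3 : m * (b * (t * K - 1)) ≤ n * t := by
      have : m * b * K * t ≤ n * t := mul_le_mul_of_nonneg_right hnb (by linarith)
      nlinarith [mul_pos hm hb]
    nlinarith [mul_le_mul_of_nonneg_left h3 (show (0:ℝ) ≤ t - 1 by linarith)]
  have ht1 : (0:ℝ) ≤ 1 - 1/t := by
    have : 1 / t ≤ 1 := by rw [div_le_one (by linarith)]; linarith
    linarith
  have h3 : 1 - ε/8 ≤ (1 - 1/t) ^ Q := by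
    have := one_add_mul_le_pow (a := -(1/t)) (by linarith) Q
    have e : (Q:ℝ) * -(1/t) = -(Q/t) := by ring
    rw [e] at this
    have e2 : 1 + -(1/t) = 1 - 1/t := by ring
    rw [e2] at this
    linarith
  have h4 : (m * (1 - 1/t)) ^ Q ≤ (n * ((t - 1) / (b * (t * K - 1)))) ^ Q := pow_le_pow_left₀ (by positivity) h2 Q
  have h5 : (0:ℝ) ≤ ((t - 1) / (b * (t * K - 1))) ^ Q := pow_nonneg (div_nonneg (by linarith) hD.le) _
  calc (d + ε/2) * m ^ Q + ε/4 * m ^ Q = (d + 3*ε/4) * m ^ Q := by ring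
    _ ≤ ((d + 7*ε/8) * (1 - ε/8)) * m ^ Q := by
        apply mul_le_mul_of_nonneg_right _ (by positivity)
        nlinarith
    _ ≤ (d + 7*ε/8) * (m * (1 - 1/t)) ^ Q := by
        rw [mul_pow, mul_assoc]
        apply mul_le_mul_of_nonneg_left _ (by positivity)
        rw [mul_comm]
        exact mul_le_mul_of_nonneg_left h3 (by positivity)
    _ ≤ (d + 7*ε/8) * (n * ((t - 1) / (b * (t * K - 1)))) ^ Q := mul_le_mul_of_nonneg_left h4 (by positivity)
    _ = ((d + 7*ε/8) * n ^ Q) * ((t - 1) / (b * (t * K - 1))) ^ Q := by rw [mul_pow]; ring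
    _ ≤ _ := mul_le_mul_of_nonneg_right h1 h5

end

lemma exp_small (k : ℕ) (c : ℝ) (hc : 0 < c) :
    ∃ X0 : ℕ, ∀ m : ℕ, X0 ≤ m → (m : ℝ) ^ k * Real.exp (-(c * m)) ≤ 1 / 4 := by
  have h1 := Real.tendsto_pow_mul_exp_neg_atTop_nhds_zero k
  have h2 := (h1.eventually (gt_mem_nhds (show (0:ℝ) < c ^ k / 4 by positivity)))
  rw [Filter.eventually_atTop] at h2
  obtain ⟨a, ha⟩ := h2
  refine ⟨⌈a / c⌉₊, fun m hm => ?_⟩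
  have h3 : a ≤ c * m := by
    have := Nat.le_of_ceil_le hm
    rw [div_le_iff₀ hc] at this
    linarith
  have h4 := ha (c * m) h3
  rw [mul_pow, mul_assoc] at h4
  have h5 : 0 < c ^ k := by positivity
  have h6 : c ^ k * ((m : ℝ) ^ k * Real.exp (-(c * m))) < c ^ k * (1 / 4) := by linarith
  exact (lt_of_mul_lt_mul_left h6 h5.le).le

lemma final_fixed2 {k : ℕ} {G : HGraph k} (H : LooseHamCycle k G) {i₀ t L b m T q K : ℕ} (j : ℕ) (hj : j < k)
    (hTd : T = TOf k t) (hqd : q = mtOf k t) (hKd : K = k - 1) (hT : 3 ≤ T) (hm : 0 < m)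
    (hmdef : m = mOf k t) (hb : b + t = L) (hb0 : 0 < b) (ht : 1 ≤ t)
    (hk : 2 ≤ k) (hmL : m * L ≤ numE G) (hmL2 : numE G ≤ m * L + m)
    (hN : G.verts.card = numE G * (k - 1)) (hi : i₀ < numE G) (d : ℝ) (hdeg : G.MinDegGe j d)
    (ε η : ℝ) (hη : 0 < η)
    (hnum : (looseHamThreshold j k + ε/2)*(m:ℝ)^(k-j) + η * (m : ℝ) ^ (k - j) ≤ (d - (G.verts.card : ℝ) ^ (k - j - 1) *
      ((((1 + 2 * q) * L + 2 * t * m + m) * K : ℕ) + k * (((L + m) * K : ℕ) : ℝ))) *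
        (((t - 1 : ℕ) : ℝ) / (b * (T - 2 : ℕ) : ℕ)) ^ (k - j))
    (χ : Finset ℕ → ℕ) (B : ℝ) (hχ : GloballyBounded G χ B)
    (hε : (k * T : ℝ) ≤ ε*m/4)
    (p0 : (T : ℝ) * ((m : ℝ) ^ j * Real.exp (-(η ^ 2 * m / 2))) ≤ 1 / 4)
    (p1 : (G.verts.card * B) * (2 ^ m * (((2 * k * T * (T - 2) : ℕ) : ℝ) / (b * (T - 2) : ℕ)) ^ k) ≤ 1 / 8)
    (p2 : ((G.verts.card : ℝ) ^ k * B) * (2 ^ m * (((2 * k * T * (T - 2) : ℕ) : ℝ) / (b * (T - 2) : ℕ)) ^ (2 * k - 1)) ≤ 1 / 8) :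
    (b : ℝ) ^ (m - 1) / 2 ≤ (({I : Finset ℕ | IsSplitting H t I ∧ I.card = mOf k t ∧ i₀ ∈ I ∧
                    Suitable χ ε (mOf k t) H t I i₀ ∧
                    ∃ X : ℕ → Finset ℕ, IsViablePartition j ε t H I X}).ncard : ℝ) := by
  subst hTd hqd hKd
  exact final_fixed H j hj hT hm hmdef hb hb0 ht hk hmL hmL2 hN hi d hdeg ε η hη hnum χ B hχ hε p0 p1 p2

lemma t_le_mt (k t : ℕ) (hk : 2 ≤ k) : t ≤ mtOf k t := by
  unfold mtOf
  exact Nat.le_self_pow (by omega) t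

set_option maxHeartbeats 2000000

/-- Lemma: many suitable splittings with viable partitions. -/
theorem many_suitable_splittings_with_viable_partitions (j k : ℕ) (hj : 1 ≤ j)
    (hjk : j < k) (ε : ℝ) (hε : 0 < ε) :
    ∃ (t : ℕ) (γ μ : ℝ) (n₀ : ℕ), 0 < t ∧ 0 < γ ∧ 0 < μ ∧
      ∀ n : ℕ, n₀ ≤ n → (k - 1) ∣ n →
        ∀ G : HGraph k, G.verts.card = n →
          G.MinDegGe j ((looseHamThreshold j k + ε) * (n : ℝ) ^ (k - j)) →
          ∀ χ : Finset ℕ → ℕ, GloballyBounded G χ (μ * (n : ℝ) ^ (k - 1)) →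
            ∀ H : LooseHamCycle k G, ∀ i₀ < numE G,
              γ * (n : ℝ) ^ (mOf k t - 1) ≤
                (({I : Finset ℕ | IsSplitting H t I ∧ I.card = mOf k t ∧ i₀ ∈ I ∧
                    Suitable χ ε (mOf k t) H t I i₀ ∧
                    ∃ X : ℕ → Finset ℕ, IsViablePartition j ε t H I X}).ncard : ℝ) := by
  have hk : 2 ≤ k := by omega
  obtain ⟨X0, hX0⟩ := exp_small k ((ε / 4) ^ 2 / 2) (by positivity)
  obtain ⟨t, ht3, htX, ht1⟩ : ∃ t : ℕ, 3 ≤ t ∧ X0 ≤ t ∧ 16 * (3 + k) / ε ≤ (t : ℝ) := by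
    refine ⟨X0 + 3 + ⌈16 * (3 + k) / ε⌉₊, by omega, by omega, ?_⟩
    have := Nat.le_ceil (16 * (3 + k) / ε)
    push_cast
    have h2 : (0:ℝ) ≤ X0 := by positivity
    linarith
  rw [div_le_iff₀ hε] at ht1
  obtain ⟨K, hK⟩ : ∃ K, K = k - 1 := ⟨_, rfl⟩
  have hK1 : 1 ≤ K := by omega
  have hKr : (1 : ℝ) ≤ K := by exact_mod_cast hK1
  have htr : (3 : ℝ) ≤ t := by exact_mod_cast ht3
  have hkr : (2 : ℝ) ≤ k := by exact_mod_cast hk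
  obtain ⟨T, hTd⟩ : ∃ T, T = TOf k t := ⟨_, rfl⟩
  have hTe : T = t * K + 1 := by rw [hTd, hK]; rfl
  have htK : t * 1 ≤ t * K := Nat.mul_le_mul_left _ hK1
  have hT3 : 3 ≤ T := by omega
  obtain ⟨q, hq⟩ : ∃ q, q = mtOf k t := ⟨_, rfl⟩
  have hqt : t ≤ q := by
    rw [hq]; exact t_le_mt k t hk
  obtain ⟨m, hmd⟩ : ∃ m, m = mOf k t := ⟨_, rfl⟩
  have hme : m = T * q := by rw [hmd, hTd, hq]; rfl
  have hTm : T ≤ m := by rw [hme]; exact Nat.le_mul_of_pos_right _ (by omega)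
  have hm : 0 < m := by omega
  have hqr : (t : ℝ) ≤ q := by exact_mod_cast hqt
  have hTr : (t : ℝ) ≤ T := by
    have : t ≤ T := by omega
    exact_mod_cast this
  have hmr : (m : ℝ) = T * q := by rw [hme]; push_cast; ring
  have hmp : (1 : ℝ) ≤ m := by exact_mod_cast hm
  obtain ⟨c, hc⟩ : ∃ c : ℝ, c = 2 * m * K := ⟨_, rfl⟩
  have hc1 : 1 ≤ c := by rw [hc]; nlinarith
  obtain ⟨A, hA⟩ : ∃ A : ℝ, A = 2 * k * T * c := ⟨_, rfl⟩
  have hA1 : 1 ≤ A := by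
    rw [hA]
    have h1 : (1:ℝ) ≤ 2 * k := by linarith
    have h2 : (1:ℝ) ≤ T := by linarith
    exact one_le_mul_of_one_le_of_one_le (one_le_mul_of_one_le_of_one_le h1 h2) hc1
  obtain ⟨μ, hμ⟩ : ∃ μ : ℝ, μ = 1 / (8 * 2 ^ m * A ^ (2 * k)) := ⟨_, rfl⟩
  have hμ0 : 0 < μ := by rw [hμ]; positivity
  obtain ⟨Cc, hCc⟩ : ∃ Cc : ℝ, Cc = (2 * t + 1 + k) * m * K := ⟨_, rfl⟩
  refine ⟨t, 1 / (2 * c ^ (m - 1)), μ, m * (2 * t + 1) * K + ⌈16 * Cc / ε⌉₊ + k, by omega, by positivity, hμ0, ?_⟩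
  intro n hn hdvd G hGn hdeg χ hχ H i₀ hi
  have hN : G.verts.card = numE G * (k - 1) := by
    unfold numE; rw [hGn, Nat.div_mul_cancel hdvd]
  obtain ⟨N, hNd⟩ : ∃ N, N = numE G := ⟨_, rfl⟩
  have hnN : n = N * K := by rw [← hGn, hN, hNd, hK]
  obtain ⟨L, hL⟩ : ∃ L, L = N / m := ⟨_, rfl⟩
  have hmL : m * L ≤ N := by rw [hL]; exact Nat.mul_div_le N m
  have hmL2 : N < m * L + m := by
    have h1 := Nat.div_add_mod N m
    have h2 := Nat.mod_lt N hm
    rw [← hL] at h1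
    omega
  have hNbig : m * (2 * t + 1) ≤ N := by
    have : m * (2 * t + 1) * K ≤ N * K := by rw [← hnN]; omega
    exact Nat.le_of_mul_le_mul_right this hK1
  have hLbig : 2 * t + 1 ≤ L := by
    rw [hL, Nat.le_div_iff_mul_le hm, mul_comm]; exact hNbig
  obtain ⟨b, hb⟩ : ∃ b, b + t = L := ⟨L - t, by omega⟩
  have hbt : t + 1 ≤ b := by omega
  have hbr : (t : ℝ) + 1 ≤ b := by exact_mod_cast hbt
  have hb0 : (0 : ℝ) < b := by linarith
  have hnr : (n : ℝ) = N * K := by rw [hnN]; push_cast; ring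
  have hn0 : 0 < n := by omega
  have hn0r : (0 : ℝ) < n := by exact_mod_cast hn0
  have hLr : (L : ℝ) = b + t := by rw [← hb]; push_cast; ring
  have hmLr : (m : ℝ) * L ≤ N := by exact_mod_cast hmL
  have hmL2r : (N : ℝ) ≤ m * L + m := by exact_mod_cast hmL2.le
  have hncb : (n : ℝ) ≤ c * b := by
    rw [hnr, hc]
    have : (N : ℝ) ≤ m * (2 * b) := by rw [hLr] at hmL2r; nlinarith
    nlinarith
  have hnb : (m : ℝ) * b * K ≤ n := by
    rw [hnr]
    apply mul_le_mul_of_nonneg_right _ (by linarith)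
    refine le_trans ?_ hmLr
    apply mul_le_mul_of_nonneg_left _ (by linarith)
    linarith
  have hCn : 16 * Cc / ε ≤ n := by
    refine (Nat.le_ceil _).trans ?_
    have : ⌈16 * Cc / ε⌉₊ ≤ n := by omega
    exact_mod_cast this
  rw [div_le_iff₀ hε] at hCn
  have hd0 := thr_nonneg j k
  have hd1 := thr_le_one G j _ n hGn hn0 (by omega) hdeg
  have hT2 : ((T - 2 : ℕ) : ℝ) = t * K - 1 := by
    have : T - 2 = t * K - 1 := by omega
    rw [this, Nat.cast_sub (by omega)]; push_cast; ring
  have hT2p : (0:ℝ) < t * K - 1 := by nlinarith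
  -- ratio
  have hratio : (((2 * k * T * (T - 2) : ℕ) : ℝ) / (b * (T - 2) : ℕ)) ≤ A / n := by
    rw [Nat.cast_mul _ (T-2), Nat.cast_mul b, Nat.cast_mul _ T, Nat.cast_mul 2, Nat.cast_ofNat]
    rw [hT2, mul_div_mul_right _ _ hT2p.ne', div_le_div_iff₀ hb0 hn0r, hA]
    have h1 : (0:ℝ) ≤ 2 * k * T := by positivity
    nlinarith [mul_le_mul_of_nonneg_left hncb h1]
  have hratio0 : 0 ≤ (((2 * k * T * (T - 2) : ℕ) : ℝ) / (b * (T - 2) : ℕ)) := by positivity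
  have hμp : ∀ e, e ≤ 2 * k → μ * (2 ^ m * A ^ e) ≤ 1 / 8 := by
    intro e he
    have h1 : A ^ e ≤ A ^ (2 * k) := pow_le_pow_right₀ hA1 he
    calc μ * (2 ^ m * A ^ e) ≤ μ * (2 ^ m * A ^ (2 * k)) := by gcongr
      _ = 1 / 8 := by rw [hμ]; field_simp
  have hmain := final_fixed2 H (i₀ := i₀) (t := t) (L := L) (b := b) (m := m) (T := T) (q := q) (K := K) j hjk hTd hq hK hT3 hm hmd hb (by omega)
    (by omega) hk (hNd ▸ hmL) (hNd ▸ hmL2.le) hN hi _ hdeg ε (ε / 4) (by positivity)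
    (by
      have := num_main (k - j) (by omega) (looseHamThreshold j k) ε n m
        ((((1 + 2 * q) * L + 2 * t * m + m) * K : ℕ) + k * (((L + m) * K : ℕ) : ℝ)) t b K hd0 hε hd1 hn0r
        (by linarith)
        (by
          push_cast
          have e1 : ((1 + 2 * (q:ℝ)) * L + 2 * t * m + m) * K + k * ((L + m) * K) =
            (1 + k + 2 * q) * (L * K) + Cc := by rw [hCc]; ring
          rw [e1]
          have e2 : (m : ℝ) * (L * K) ≤ n := by
            rw [hnr, ← mul_assoc]; exact mul_le_mul_of_nonneg_right hmLr (by linarith)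
          have e3 : (1 + k + 2 * (q:ℝ)) ≤ (3 + k) * q := by nlinarith
          have e4 : (3 + (k:ℝ)) * q * 16 ≤ ε * m := by
            rw [hmr]
            have : 16 * (3 + (k:ℝ)) ≤ ε * T := by nlinarith
            nlinarith
          have e5 : (0:ℝ) ≤ L * K := by positivity
          have e6 : (1 + k + 2 * (q:ℝ)) * (L * K) * 16 ≤ ε * n := by
            calc _ = (1 + k + 2 * (q:ℝ)) * 16 * (L * K) := by ring
              _ ≤ (ε * m) * (L * K) := by
                apply mul_le_mul_of_nonneg_right _ e5
                linarith
              _ = ε * (m * (L * K)) := by ring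
              _ ≤ _ := mul_le_mul_of_nonneg_left e2 hε.le
          linarith)
        (by linarith) hb0 hKr
        (by
          rw [div_le_iff₀ (by linarith)]
          have : ((k - j : ℕ) : ℝ) ≤ k := by exact_mod_cast Nat.sub_le k j
          nlinarith)
        hnb
      rw [hGn, Nat.cast_sub (by omega : 1 ≤ t), Nat.cast_mul b, hT2]
      push_cast at this ⊢
      exact this)
    χ _ hχ
    (by
      rw [hmr]
      have h1 : 4 * (k:ℝ) ≤ ε * q := by nlinarith
      have h2 : (0:ℝ) ≤ T := by positivity
      nlinarith)
    (by
      have h1 := hX0 m (by omega)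
      have e1 : (ε / 4) ^ 2 / 2 * (m:ℝ) = (ε / 4) ^ 2 * m / 2 := by ring
      rw [e1] at h1
      refine le_trans ?_ h1
      rw [← mul_assoc]
      apply mul_le_mul_of_nonneg_right _ (Real.exp_pos _).le
      have h2 : (T : ℝ) ≤ m := by exact_mod_cast hTm
      calc (T:ℝ) * (m:ℝ) ^ j ≤ m * (m:ℝ) ^ j := by gcongr
        _ = (m:ℝ) ^ (j + 1) := by ring
        _ ≤ _ := pow_le_pow_right₀ hmp (by omega))
    (by
      rw [hGn]
      have h1 := pow_le_pow_left₀ hratio0 hratio k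
      calc _ ≤ ((n:ℝ) * (μ * (n:ℝ) ^ (k - 1))) * (2 ^ m * (A / n) ^ k) := by
            gcongr
        _ = μ * (2 ^ m * A ^ k) := by
            have e : (n:ℝ) ^ k = n * (n:ℝ) ^ (k - 1) := by
              rw [← pow_succ']; congr 1; omega
            rw [div_pow, e]; field_simp
        _ ≤ _ := hμp k (by omega))
    (by
      rw [hGn]
      have h1 := pow_le_pow_left₀ hratio0 hratio (2 * k - 1)
      calc _ ≤ ((n:ℝ) ^ k * (μ * (n:ℝ) ^ (k - 1))) * (2 ^ m * (A / n) ^ (2 * k - 1)) := by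
            gcongr
        _ = μ * (2 ^ m * A ^ (2 * k - 1)) := by
            have e : (n:ℝ) ^ (2 * k - 1) = (n:ℝ) ^ k * (n:ℝ) ^ (k - 1) := by
              rw [← pow_add]; congr 1; omega
            rw [div_pow, e]; field_simp
        _ ≤ _ := hμp _ (by omega))
  refine le_trans ?_ hmain
  rw [← hmd]
  have h1 : (n : ℝ) ^ (m - 1) ≤ (c * b) ^ (m - 1) := pow_le_pow_left₀ hn0r.le hncb _
  have hcp : 0 < c ^ (m - 1) := by positivity
  rw [mul_pow] at h1
  rw [one_div, inv_mul_le_iff₀ (by positivity)]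
  linarith

end
end
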